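/- arXiv:2508.09739 — 2 statements merged into one kernel-verified Lean document; each statement's English description precedes it below -/
import Mathlib

section
/- Let p be an odd prime. There exist a field F and a continuous homomorphism ρ : Gal(F_s/F) → GL_3(𝔽_p) that admits no lift to a continuous homomorphism Gal(F_s/F) → GL_3(ℤ/p²) along the reduction ℤ/p² → ℤ/p. -/
open scoped MatrixGroups

/-- The absolute Galois group `Gal(F_s/F)`, with its Krull topology. -/
abbrev AbsGal (F : Type) [Field F] : Type :=
  SeparableClosure F ≃ₐ[F] SeparableClosure F

section Hahn

/-- The ring homomorphism `∑ aᵧ Tᵞ ↦ ∑ f aᵧ * χ γ Tᵞ` on Hahn series. -/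
noncomputable def HahnSeries.twist {Γ R S : Type*} [AddCommMonoid Γ] [LinearOrder Γ]
    [IsOrderedCancelAddMonoid Γ]
    [CommRing R] [CommRing S] (f : R →+* S) (χ : Multiplicative Γ →* S) :
    HahnSeries Γ R →+* HahnSeries Γ S where
  toFun x :=
    { coeff := fun γ => f (x.coeff γ) * χ (Multiplicative.ofAdd γ)
      isPWO_support' := x.isPWO_support.mono (Function.support_subset_iff'.2 fun γ hγ => by
        rw [HahnSeries.mem_support, not_not] at hγ
        simp [hγ]) }
  map_zero' := by ext; simp
  map_one' := by
    ext γ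
    by_cases h : γ = 0
    · subst h; simp
    · simp [HahnSeries.coeff_one, h]
  map_add' x y := by ext; simp [add_mul]
  map_mul' x y := by
    ext γ
    simp only [HahnSeries.coeff_mul, map_sum, Finset.sum_mul]
    symm
    have aux : ∀ z : HahnSeries Γ R, ∀ i, i ∉ z.support → f (z.coeff i) = 0 := by
      intro z i hi
      rw [HahnSeries.mem_support, not_not] at hi
      rw [hi, map_zero]
    refine (Finset.sum_subset ?_ ?_).trans (Finset.sum_congr rfl ?_)
    · intro i hi
      simp only [Finset.mem_antidiagonal] at hi ⊢
      refine ⟨?_, ?_, hi.2.2⟩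
      · by_contra h; exact hi.1 (by simp [aux x _ h])
      · by_contra h; exact hi.2.1 (by simp [aux y _ h])
    · intro i hi hi'
      simp only [Finset.mem_antidiagonal] at hi hi'
      by_contra h
      exact hi' ⟨fun h' => h (by simp only at h'; simp [h']),
        fun h' => h (by simp only at h'; simp [h']), hi.2.2⟩
    · intro i hi
      simp only [Finset.mem_antidiagonal] at hi
      rw [← hi.2.2, ofAdd_add, map_mul, map_mul]
      ring

section
variable {Γ R S : Type*} [AddCommMonoid Γ] [LinearOrder Γ] [IsOrderedCancelAddMonoid Γ]
    [CommRing R] [CommRing S]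

@[simp]
theorem HahnSeries.coeff_twist (f : R →+* S) (χ : Multiplicative Γ →* S) (x : HahnSeries Γ R)
    (γ : Γ) :
    (HahnSeries.twist f χ x).coeff γ = f (x.coeff γ) * χ (Multiplicative.ofAdd γ) := rfl

theorem HahnSeries.twist_single (f : R →+* S) (χ : Multiplicative Γ →* S) (γ : Γ) (a : R) :
    HahnSeries.twist f χ (HahnSeries.single γ a) =
      HahnSeries.single γ (f a * χ (Multiplicative.ofAdd γ)) := by
  ext δ
  by_cases h : δ = γ
  · subst h; simp
  · simp [HahnSeries.coeff_single_of_ne h]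
end

theorem PowerSeries.exists_pow_eq_one_add_X {k : Type*} [Field k] {p : ℕ} (hp : (p : k) ≠ 0) :
    ∃ r : PowerSeries k, r ^ p = 1 + PowerSeries.X := by
  have hp0 : p ≠ 0 := by rintro rfl; simp at hp
  have := (HenselianRing.is_henselian (R := PowerSeries k) (I := Ideal.span {PowerSeries.X})
    (Polynomial.X ^ p - Polynomial.C (1 + PowerSeries.X))
    (Polynomial.monic_X_pow_sub_C _ hp0) 1 ?_ ?_)
  · obtain ⟨a, ha, -⟩ := this
    refine ⟨a, ?_⟩
    simpa [sub_eq_zero] using ha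
  · simp
  · have : IsUnit ((p : PowerSeries k)) := by
      have := (IsUnit.mk0 (p : k) hp).map (PowerSeries.C (R := k))
      simpa using this
    have h := this.map (Ideal.Quotient.mk (Ideal.span {(PowerSeries.X : PowerSeries k)}))
    rw [Polynomial.derivative_sub, Polynomial.derivative_C, sub_zero, Polynomial.derivative_X_pow,
      Polynomial.eval_mul, Polynomial.eval_pow, Polynomial.eval_X, one_pow, mul_one,
      Polynomial.eval_C]
    exact h

theorem HahnSeries.exists_pow_eq {Γ k : Type*} [AddCommGroup Γ] [LinearOrder Γ]
    [IsOrderedAddMonoid Γ] [Field k] {p : ℕ} (hp : (p : k) ≠ 0)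
    (hk : ∀ a : k, ∃ b, b ^ p = a) (hΓ : ∀ a : Γ, ∃ b, p • b = a)
    (x : HahnSeries Γ k) : ∃ y, y ^ p = x := by
  by_cases hx : x = 0
  · exact ⟨0, by subst hx; rw [zero_pow]; rintro rfl; simp at hp⟩
  obtain ⟨γ, hγ⟩ := hΓ x.order
  obtain ⟨c, hc⟩ := hk x.leadingCoeff
  have hL : (HahnSeries.single x.order x.leadingCoeff) ≠ 0 := by
    simpa using hx
  obtain ⟨w, hw⟩ : ∃ w, x = HahnSeries.single x.order x.leadingCoeff * w :=
    ⟨x / HahnSeries.single x.order x.leadingCoeff, by field_simp⟩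
  have hw0 : w ≠ 0 := by rintro rfl; exact hx (by simpa using hw)
  have hw1 : w.leadingCoeff = 1 := by
    have := congrArg HahnSeries.leadingCoeff hw
    rw [HahnSeries.leadingCoeff_mul, HahnSeries.leadingCoeff_of_single] at this
    exact (mul_eq_left₀ (by simpa using hx)).1 this.symm
  have hw2 : w.order = 0 := by
    have := congrArg HahnSeries.order hw
    rw [HahnSeries.order_mul hL hw0, HahnSeries.order_single (by simpa using hx)] at this
    simpa using this
  have hε0 : 0 < (w - 1).orderTop := by
    rw [HahnSeries.orderTop_self_sub_one_pos_iff, ← HahnSeries.order_eq_orderTop_of_ne_zero hw0,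
      hw2]
    exact ⟨rfl, hw1⟩
  obtain ⟨r, hr⟩ := PowerSeries.exists_pow_eq_one_add_X hp
  refine ⟨HahnSeries.single γ c * PowerSeries.heval (w - 1) r, ?_⟩
  rw [mul_pow, ← map_pow (PowerSeries.heval (w - 1)), hr, map_add, map_one,
    PowerSeries.heval_X _ hε0, HahnSeries.single_pow, hc, hγ, add_sub_cancel]
  exact hw.symm

/-- The automorphism `∑ aᵧ Tᵞ ↦ ∑ f aᵧ * χ γ Tᵞ` of Hahn series. -/
noncomputable def HahnSeries.twistEquiv {Γ R : Type*} [AddCommMonoid Γ] [LinearOrder Γ]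
    [IsOrderedCancelAddMonoid Γ] [CommRing R] (f : R ≃+* R) (χ : Multiplicative Γ →* Rˣ) :
    HahnSeries Γ R ≃+* HahnSeries Γ R :=
  RingEquiv.ofRingHom (HahnSeries.twist f ((Units.coeHom R).comp χ))
    (HahnSeries.twist f.symm ((Units.coeHom R).comp ((Units.map (f.symm : R →* R)).comp χ⁻¹)))
    (by ext x γ; simp [mul_assoc])
    (by ext x γ; simp [mul_assoc, ← map_mul])

@[simp]
theorem HahnSeries.coeff_twistEquiv {Γ R : Type*} [AddCommMonoid Γ] [LinearOrder Γ]
    [IsOrderedCancelAddMonoid Γ] [CommRing R] (f : R ≃+* R) (χ : Multiplicative Γ →* Rˣ)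
    (x : HahnSeries Γ R) (γ : Γ) :
    (HahnSeries.twistEquiv f χ x).coeff γ = f (x.coeff γ) * χ (Multiplicative.ofAdd γ) := rfl

theorem HahnSeries.coeff_twistEquiv_refl_pow {Γ R : Type*} [AddCommMonoid Γ] [LinearOrder Γ]
    [IsOrderedCancelAddMonoid Γ] [CommRing R] (χ : Multiplicative Γ →* Rˣ) (n : ℕ)
    (x : HahnSeries Γ R) (γ : Γ) :
    ((HahnSeries.twistEquiv (RingEquiv.refl R) χ ^ n : RingAut (HahnSeries Γ R)) x).coeff γ =
      x.coeff γ * (χ (Multiplicative.ofAdd γ) : R) ^ n := by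
  induction n generalizing x with
  | zero => simp
  | succ n ih => rw [pow_succ, RingAut.mul_apply, ih]; simp [pow_succ']; ring

theorem exists_character {J k : Type*} [Field k] [IsAlgClosed k] {v : J → ℝ}
    (hv : LinearIndependent ℤ v) (c : J → kˣ) :
    ∃ χ : Multiplicative ℝ →* kˣ, ∀ j, χ (Multiplicative.ofAdd (v j)) = c j := by
  have hroot : ∀ {n : ℕ}, n ≠ 0 → ∀ a : kˣ, ∃ b : kˣ, b ^ n = a := by
    intro n hn a
    obtain ⟨z, hz⟩ := IsAlgClosed.exists_pow_nat_eq (a : k) (Nat.pos_of_ne_zero hn)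
    refine ⟨Units.mk0 z ?_, Units.ext hz⟩
    rintro rfl
    rw [zero_pow hn] at hz
    exact a.ne_zero hz.symm
  let _ : DivisibleBy (Additive kˣ) ℕ := divisibleByOfSMulRightSurj _ _ fun {n} hn a =>
    ⟨Additive.ofMul (hroot hn a.toMul).choose,
      congrArg Additive.ofMul (hroot hn a.toMul).choose_spec⟩
  let _ : DivisibleBy (Additive kˣ) ℤ := AddGroup.divisibleByIntOfDivisibleByNat _
  obtain ⟨h, hh⟩ := (Module.Baer.of_divisible (Additive kˣ)).extension_property_addMonoidHom
    (Finsupp.linearCombination ℤ v).toAddMonoidHom hv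
    (Finsupp.linearCombination ℤ fun j => Additive.ofMul (c j)).toAddMonoidHom
  refine ⟨AddMonoidHom.toMultiplicativeLeft h, fun j => ?_⟩
  have := DFunLike.congr_fun hh (Finsupp.single j 1)
  simp at this
  exact congrArg Additive.toMul this

theorem exists_linearIndependent_real (J : Type) [Countable J] :
    ∃ v : J → ℝ, LinearIndependent ℤ v := by
  have h : Cardinal.mk J ≤ Module.rank ℚ ℝ := by
    rw [Real.rank_rat_real]
    exact (Cardinal.mk_le_aleph0).trans Cardinal.aleph0_le_continuum
  obtain ⟨s, hs, hs'⟩ := le_rank_iff_exists_linearIndependent.1 h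
  obtain ⟨e⟩ := Cardinal.eq.1 hs
  have h1 := hs'.comp e.symm e.symm.injective
  exact ⟨_, h1.restrict_scalars (by intro a b hab; simpa using hab)⟩

theorem MvPolynomial.eval₂Hom_C_single_injective {J k : Type*} [Field k] {v : J → ℝ}
    (hv : LinearIndependent ℤ v) :
    Function.Injective (MvPolynomial.eval₂Hom (HahnSeries.C (Γ := ℝ) (R := k))
      fun j => HahnSeries.single (v j) (1 : k)) := by
  have hinj : Function.Injective fun d : J →₀ ℕ => d.sum fun j n => n • v j := by
    intro d e hde
    have h1 : ∀ d : J →₀ ℕ, (d.sum fun j n => n • v j) =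
        Finsupp.linearCombination ℤ v (d.mapRange Nat.cast Nat.cast_zero) := by
      intro d
      rw [Finsupp.linearCombination_apply, Finsupp.sum_mapRange_index (by simp)]
      simp
    simp only [h1] at hde
    have := hv hde
    ext j
    have := DFunLike.congr_fun this j
    simpa using this
  have hmon : ∀ (d : J →₀ ℕ) (a : k), MvPolynomial.eval₂Hom (HahnSeries.C (Γ := ℝ) (R := k))
      (fun j => HahnSeries.single (v j) (1 : k)) (MvPolynomial.monomial d a) =
      HahnSeries.single (d.sum fun j n => n • v j) a := by
    intro d a
    let m : Multiplicative ℝ →* HahnSeries ℝ k :=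
      { toFun := fun γ => HahnSeries.single γ.toAdd 1
        map_one' := rfl
        map_mul' := fun x y => by simp }
    have h2 : (d.prod fun j n => HahnSeries.single (v j) (1 : k) ^ n) =
        m (d.prod fun j n => Multiplicative.ofAdd (v j) ^ n) := by
      rw [map_finsuppProd]
      simp [m]
    have h3 : Multiplicative.toAdd (d.prod fun j n => Multiplicative.ofAdd (v j) ^ n) =
        d.sum fun j n => n • v j := by
      simp [Finsupp.prod, Finsupp.sum, toAdd_prod]
    rw [MvPolynomial.coe_eval₂Hom, MvPolynomial.eval₂_monomial, h2]
    simp only [m, MonoidHom.coe_mk, OneHom.coe_mk, h3, HahnSeries.C_apply]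
    simp
  have hcoeff : ∀ (P : MvPolynomial J k) (d : J →₀ ℕ),
      (MvPolynomial.eval₂Hom (HahnSeries.C (Γ := ℝ) (R := k))
      (fun j => HahnSeries.single (v j) (1 : k)) P).coeff (d.sum fun j n => n • v j) =
      P.coeff d := by
    classical
    intro P d
    induction P using MvPolynomial.induction_on' with
    | monomial e a =>
      rw [hmon, MvPolynomial.coeff_monomial, HahnSeries.coeff_single]
      simp only [hinj.eq_iff, eq_comm]
    | add p q hp hq => rw [map_add, HahnSeries.coeff_add, hp, hq, MvPolynomial.coeff_add]
  intro P Q h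
  ext d
  rw [← hcoeff, ← hcoeff, h]

theorem IsPrimitiveRoot.sum_inv_pow_mul {k : Type*} [Field k] {p : ℕ} {ζ : k}
    (hζ : IsPrimitiveRoot ζ p) {a : ℕ} (ha : a < p) :
    ∑ m ∈ Finset.range p, ζ⁻¹ ^ (a * m) = if a = 0 then (p : k) else 0 := by
  split_ifs with h
  · simp [h]
  · have h1 : (ζ⁻¹ ^ a) ≠ 1 := fun h1 =>
      h (Nat.eq_zero_of_dvd_of_lt ((hζ.inv.pow_eq_one_iff_dvd a).1 h1) ha)
    have h2 := mul_geom_sum (ζ⁻¹ ^ a) p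
    rw [← pow_mul, mul_comm a p, pow_mul, hζ.inv.pow_eq_one, one_pow, sub_self, mul_eq_zero] at h2
    simpa [pow_mul] using h2.resolve_left (sub_ne_zero.2 h1)

/-- The Fourier substitution `Xᵢ ↦ ∑ ζ⁻ᵃᵐ X_{πᵃ i, m}` diagonalising a permutation of order
dividing `p`. -/
noncomputable def fourierSubst {ι k₀ k : Type*} [Field k₀] [Field k] (f : k₀ →+* k) (ζ : k) (p : ℕ)
    (π : Equiv.Perm ι) : MvPolynomial ι k₀ →+* MvPolynomial (ι × ℕ) k :=
  MvPolynomial.eval₂Hom (MvPolynomial.C.comp f) fun i =>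
    ∑ a ∈ Finset.range p, ∑ m ∈ Finset.range p,
      MvPolynomial.C (ζ⁻¹ ^ (a * m)) * MvPolynomial.X ((π ^ a) i, m)

theorem fourierSubst_injective {ι k₀ k : Type*} [Field k₀] [Field k] (f : k₀ →+* k) {ζ : k} {p : ℕ}
    (hζ : IsPrimitiveRoot ζ p) (hp : (p : k) ≠ 0) (π : Equiv.Perm ι) :
    Function.Injective (fourierSubst f ζ p π) := by
  let r : MvPolynomial (ι × ℕ) k →+* MvPolynomial ι k :=
    MvPolynomial.eval₂Hom MvPolynomial.C fun x => MvPolynomial.C (p : k)⁻¹ * MvPolynomial.X x.1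
  have hr : r.comp (fourierSubst f ζ p π) = MvPolynomial.map f := by
    refine MvPolynomial.ringHom_ext (fun c => by simp [r, fourierSubst]) fun i => ?_
    have hp0 : 0 < p := Nat.pos_of_ne_zero (by rintro rfl; simp at hp)
    have key : ∀ a ∈ Finset.range p, ∑ m ∈ Finset.range p, (MvPolynomial.C (ζ⁻¹ ^ (a * m)) *
        (MvPolynomial.C (p : k)⁻¹ * MvPolynomial.X ((π ^ a) i)) : MvPolynomial ι k) =
        if a = 0 then MvPolynomial.X i else 0 := by
      intro a ha
      rw [← Finset.sum_mul, ← map_sum, hζ.sum_inv_pow_mul (Finset.mem_range.1 ha)]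
      split_ifs with h
      · subst h
        rw [← mul_assoc, ← map_mul, mul_inv_cancel₀ hp]
        simp
      · simp
    simp only [RingHom.comp_apply, fourierSubst, MvPolynomial.coe_eval₂Hom, MvPolynomial.eval₂_X,
      map_sum, map_mul, r, MvPolynomial.eval₂_C, MvPolynomial.map_X]
    rw [Finset.sum_congr rfl key]
    simp [hp0]
  have : Function.Injective (r.comp (fourierSubst f ζ p π)) := by
    rw [hr]; exact MvPolynomial.map_injective _ f.injective
  rw [RingHom.coe_comp] at this
  exact this.of_comp

/-- Realisation of a permutation of variables of order dividing `p` inside a maximally complete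
field, together with a Frobenius automorphism acting on it through tame relations. -/
theorem exists_tame_realization {p l : ℕ} [Fact p.Prime] [Fact l.Prime] {ζ : ZMod l}
    (hζ : IsPrimitiveRoot ζ p) {ι : Type} [Countable ι] {π : Equiv.Perm ι} (hπ : π ^ p = 1) :
    ∃ (Ω : Type) (_ : Field Ω) (φ : FractionRing (MvPolynomial ι (ZMod l)) →+* Ω)
      (υ σ : RingAut Ω), (∀ x : Ω, ∃ y, y ^ p = x) ∧
      (∀ i, υ (φ (algebraMap (MvPolynomial ι (ZMod l)) _ (MvPolynomial.X i))) =
        φ (algebraMap (MvPolynomial ι (ZMod l)) _ (MvPolynomial.X (π i)))) ∧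
      (∀ x, σ (φ x) = φ x) ∧ σ * υ = υ ^ l * σ ∧
      ∃ κ : AlgebraicClosure (ZMod l) →+* Ω, ∀ c, υ (κ c) = κ c ∧ σ (κ c) = κ c ^ l := by
  let k := AlgebraicClosure (ZMod l)
  have : NeZero p := ⟨(Fact.out : p.Prime).ne_zero⟩
  have hpl : (p : ZMod l) ≠ 0 := hζ.neZero'.out
  have hpk : (p : k) ≠ 0 := by
    intro h
    apply hpl
    apply (algebraMap (ZMod l) k).injective
    simpa using h
  have hζk : IsPrimitiveRoot (algebraMap (ZMod l) k ζ) p :=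
    hζ.map_of_injective (algebraMap (ZMod l) k).injective
  set z : k := algebraMap (ZMod l) k ζ with hz
  have hz0 : z ≠ 0 := hζk.ne_zero (Fact.out : p.Prime).ne_zero
  obtain ⟨v, hv⟩ := exists_linearIndependent_real (ι × ℕ)
  obtain ⟨χ, hχ⟩ := exists_character (k := k) hv fun x => Units.mk0 z hz0 ^ x.2
  let φ₀ : MvPolynomial ι (ZMod l) →+* HahnSeries ℝ k :=
    (MvPolynomial.eval₂Hom HahnSeries.C fun j => HahnSeries.single (v j) (1 : k)).comp
      (fourierSubst (algebraMap (ZMod l) k) z p π)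
  have hφ₀ : Function.Injective φ₀ :=
    (MvPolynomial.eval₂Hom_C_single_injective hv).comp (fourierSubst_injective _ hζk hpk π)
  have hφ₀X : ∀ i, φ₀ (MvPolynomial.X i) = ∑ a ∈ Finset.range p, ∑ m ∈ Finset.range p,
      HahnSeries.single (v ((π ^ a) i, m)) (z⁻¹ ^ (a * m)) := by
    intro i
    simp [φ₀, fourierSubst, HahnSeries.C_apply]
  let υ : RingAut (HahnSeries ℝ k) := HahnSeries.twistEquiv (RingEquiv.refl k) χ
  let σ : RingAut (HahnSeries ℝ k) := HahnSeries.twistEquiv (frobeniusEquiv k l) 1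
  have hυs : ∀ γ c, υ (HahnSeries.single γ c) =
      HahnSeries.single γ (c * χ (Multiplicative.ofAdd γ)) :=
    fun γ c => HahnSeries.twist_single _ _ _ _
  have hσs : ∀ γ c, σ (HahnSeries.single γ c) = HahnSeries.single γ (c ^ l) := fun γ c =>
    (HahnSeries.twist_single _ _ _ _).trans (by simp [frobenius_def])
  refine ⟨HahnSeries ℝ k, inferInstance, IsFractionRing.lift hφ₀, υ, σ, ?_, ?_, ?_, ?_, ?_⟩
  · exact HahnSeries.exists_pow_eq hpk
      (fun a => IsAlgClosed.exists_pow_nat_eq a (Fact.out : p.Prime).pos) fun a => ⟨a / p, by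
        have : (p : ℝ) ≠ 0 := by exact_mod_cast (Fact.out : p.Prime).ne_zero
        rw [nsmul_eq_mul]; field_simp⟩
  · intro i
    rw [IsFractionRing.lift_algebraMap, IsFractionRing.lift_algebraMap, hφ₀X, hφ₀X]
    simp only [map_sum, hυs, hχ]
    set g : ℕ → HahnSeries ℝ k := fun a => ∑ m ∈ Finset.range p,
      HahnSeries.single (v ((π ^ a) i, m)) (z⁻¹ ^ (a * m) * z ^ m) with hg
    have h1 : ∀ a, ∑ m ∈ Finset.range p, HahnSeries.single (v ((π ^ a) (π i), m)) (z⁻¹ ^ (a * m)) =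
        g (a + 1) := by
      intro a
      refine Finset.sum_congr rfl fun m _ => ?_
      rw [pow_succ, Equiv.Perm.mul_apply, add_mul, one_mul, pow_add, mul_assoc, ← mul_pow,
        inv_mul_cancel₀ hz0, one_pow, mul_one]
    have h2 : g p = g 0 := by
      refine Finset.sum_congr rfl fun m _ => ?_
      rw [hπ, pow_mul, hζk.inv.pow_eq_one]
      simp
    simp only [h1]
    have h3 := Finset.sum_range_succ g p
    rw [Finset.sum_range_succ', h2] at h3
    refine Eq.trans ?_ (add_right_cancel h3).symm
    refine Finset.sum_congr rfl fun a _ => Finset.sum_congr rfl fun m _ => ?_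
    simp
  · let φ : FractionRing (MvPolynomial ι (ZMod l)) →+* HahnSeries ℝ k := IsFractionRing.lift hφ₀
    have : (σ : HahnSeries ℝ k →+* HahnSeries ℝ k).comp φ = φ := by
      refine IsLocalization.ringHom_ext (nonZeroDivisors (MvPolynomial ι (ZMod l)))
        (MvPolynomial.ringHom_ext (fun c => ?_) fun i => ?_)
      · exact RingHom.congr_fun (Subsingleton.elim (α := ZMod l →+* HahnSeries ℝ k)
          ((((σ : HahnSeries ℝ k →+* HahnSeries ℝ k).comp φ).comp
            (algebraMap _ _)).comp MvPolynomial.C)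
          ((φ.comp (algebraMap _ _)).comp MvPolynomial.C)) c
      · rw [RingHom.comp_apply, RingHom.comp_apply, RingHom.comp_apply,
          IsFractionRing.lift_algebraMap, hφ₀X]
        simp only [map_sum, RingHom.coe_coe, hσs]
        refine Finset.sum_congr rfl fun a _ => Finset.sum_congr rfl fun m _ => ?_
        rw [hz, ← map_inv₀, ← map_pow, ← map_pow, ZMod.pow_card]
    exact fun x => RingHom.congr_fun this x
  · refine RingEquiv.ext fun x => HahnSeries.ext (funext fun γ => ?_)
    rw [RingAut.mul_apply, RingAut.mul_apply, HahnSeries.coeff_twistEquiv_refl_pow]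
    simp [σ, υ, frobenius_def, mul_pow]
  · refine ⟨HahnSeries.C, fun c => ⟨?_, ?_⟩⟩
    · rw [HahnSeries.C_apply, hυs]; simp
    · rw [← map_pow, HahnSeries.C_apply, HahnSeries.C_apply, hσs]

end Hahn

section Transfer

theorem IsPGroup.exists_normal_index_eq {G : Type*} [Group G] [Finite G] {p : ℕ} [Fact p.Prime]
    (hG : IsPGroup p G) [Nontrivial G] : ∃ H : Subgroup G, H.Normal ∧ H.index = p := by
  obtain ⟨n, hn0, hn⟩ := hG.nontrivial_iff_card.1 inferInstance
  obtain ⟨m, rfl⟩ : ∃ m, n = m + 1 := ⟨n - 1, by omega⟩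
  obtain ⟨H, hH⟩ := Sylow.exists_subgroup_card_pow_prime (G := G) p (n := m)
    (hn ▸ pow_dvd_pow p (Nat.le_succ m))
  have hp := (Fact.out : p.Prime)
  have hidx : H.index = p := by
    have := H.card_mul_index
    rw [hH, hn, pow_succ] at this
    exact Nat.eq_of_mul_eq_mul_left (pow_pos hp.pos m) this
  refine ⟨H, Subgroup.normal_of_index_eq_minFac_card ?_, hidx⟩
  rw [hidx, hn, Nat.pow_minFac (Nat.succ_ne_zero m), hp.minFac_eq]

/-- Over a field containing the `p`-th roots of unity in which every element is a `p`-th power,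
Galois groups have no nontrivial continuous finite `p`-quotients. -/
theorem monoidHom_galois_eq_one_of_forall_exists_pow_eq {J E C : Type*} [Field J] [Field E]
    [Algebra J E] [IsGalois J E] [Group C] [Finite C] {p : ℕ} [Fact p.Prime] {ζ : J}
    (hζ : IsPrimitiveRoot ζ p) (hJ : ∀ a : J, ∃ b, b ^ p = a)
    (Φ : Gal(E/J) →* C) (hΦ : IsOpen (Φ.ker : Set Gal(E/J))) (hp : IsPGroup p Φ.range) : Φ = 1 := by
  by_contra hne
  have hnt : Nontrivial Φ.range := by
    rw [Subgroup.nontrivial_iff_ne_bot, Ne, MonoidHom.range_eq_bot_iff]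
    exact hne
  obtain ⟨H, hHn, hHi⟩ := hp.exists_normal_index_eq
  let M : Subgroup Gal(E/J) := H.comap Φ.rangeRestrict
  have hMn : M.Normal := hHn.comap _
  have hMi : M.index = p := by
    rw [Subgroup.index_comap_of_surjective _ Φ.rangeRestrict_surjective, hHi]
  have hMo : IsOpen (M : Set Gal(E/J)) := by
    refine Subgroup.isOpen_mono (H₁ := Φ.ker) (fun g hg => ?_) hΦ
    have : Φ.rangeRestrict g = 1 := Subtype.ext hg
    simp [M, Subgroup.mem_comap, this]
  let Mc : ClosedSubgroup Gal(E/J) := ⟨M, M.isClosed_of_isOpen hMo⟩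
  have : Mc.Normal := hMn
  have hfix := InfiniteGalois.fixingSubgroup_fixedField Mc
  set D := IntermediateField.fixedField (Mc : Subgroup Gal(E/J)) with hD
  have hD' : FiniteDimensional J D ∧ IsGalois J D := by
    rw [← InfiniteGalois.isOpen_and_normal_iff_finite_and_isGalois, hfix]
    exact ⟨hMo, hMn⟩
  obtain ⟨_, _⟩ := hD'
  have hcard : Nat.card Gal(D/J) = p := by
    rw [← Nat.card_congr (InfiniteGalois.normalAutEquivQuotient Mc).toEquiv]
    exact hMi
  have hcyc : IsCyclic Gal(D/J) := isCyclic_of_prime_card hcard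
  have hfr : Module.finrank J D = p := by
    rw [← IsGalois.card_aut_eq_finrank, hcard]
  obtain ⟨x, ⟨a, ha⟩, hx⟩ := exists_root_adjoin_eq_top_of_isCyclic J D
    (by rw [hfr]; exact ⟨ζ, (mem_primitiveRoots (Fact.out : p.Prime).pos).2 hζ⟩)
  obtain ⟨b, rfl⟩ := hJ a
  rw [hfr, map_pow] at ha
  have hxm : x ∈ Set.range (algebraMap J D) := by
    have hp0 : p ≠ 0 := (Fact.out : p.Prime).ne_zero
    by_cases hb : algebraMap J D b = 0
    · rw [hb, zero_pow hp0, eq_comm, pow_eq_zero_iff hp0] at ha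
      exact ⟨0, by rw [ha, map_zero]⟩
    have h1 : (x / algebraMap J D b) ^ p = 1 := by
      rw [div_pow, ← ha, div_self (pow_ne_zero p hb)]
    have : NeZero p := ⟨hp0⟩
    obtain ⟨i, -, hi⟩ := (hζ.map_of_injective (algebraMap J D).injective).eq_pow_of_pow_eq_one h1
    refine ⟨ζ ^ i * b, ?_⟩
    rw [map_mul, map_pow, hi, div_mul_cancel₀ _ hb]
  have hbot : (⊥ : IntermediateField J D) = ⊤ := by
    rw [← hx, eq_comm, IntermediateField.adjoin_simple_eq_bot_iff, IntermediateField.mem_bot]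
    exact hxm
  have h2 : Module.finrank J D = 1 := by
    rw [← IntermediateField.finrank_top', ← hbot, IntermediateField.finrank_bot]
  rw [hfr] at h2
  exact (Fact.out : p.Prime).one_lt.ne' h2

theorem Subgroup.isOpen_galois_iff_exists_finset {K E : Type*} [Field K] [Field E] [Algebra K E]
    [Algebra.IsIntegral K E] (H : Subgroup Gal(E/K)) :
    IsOpen (H : Set Gal(E/K)) ↔ ∃ s : Finset E, ∀ g : Gal(E/K), (∀ x ∈ s, g x = x) → g ∈ H := by
  constructor
  · intro h
    obtain ⟨F, hF, hFH⟩ := (krullTopology_mem_nhds_one_iff K E _).1 (h.mem_nhds H.one_mem)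
    let b := Module.finBasis K F
    classical
    refine ⟨Finset.univ.image fun i => (b i : E), fun g hg => hFH ?_⟩
    have h1 : g.toAlgHom.comp F.val = F.val := by
      refine AlgHom.toLinearMap_injective (b.ext fun i => ?_)
      exact hg _ (Finset.mem_image_of_mem _ (Finset.mem_univ i))
    rw [SetLike.mem_coe, IntermediateField.mem_fixingSubgroup_iff]
    exact fun x hx => DFunLike.congr_fun h1 ⟨x, hx⟩
  · rintro ⟨s, hs⟩
    refine Subgroup.isOpen_mono (H₁ := ⨅ x ∈ s, MulAction.stabilizer Gal(E/K) x) (fun g hg => ?_) ?_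
    · simp only [Subgroup.mem_iInf, MulAction.mem_stabilizer_iff] at hg
      exact hs g hg
    · rw [Subgroup.coe_iInf]
      simp only [Subgroup.coe_iInf]
      exact isOpen_biInter_finset fun x _ => stabilizer_isOpen_of_isIntegral x

theorem exists_monoidHom_of_isSepClosed {K L E Ω k C : Type*} [Field K] [Field L] [Field E]
    [Field Ω]
    [Field k] [Algebra K L] [Algebra K E] [Algebra L E] [IsScalarTower K L E] [Algebra K Ω]
    [Algebra L Ω] [IsScalarTower K L Ω] [Algebra.IsSeparable K L] [IsGalois K E] [IsSepClosed E]
    [IsAlgClosed k] [Group C] [Finite C] {p l : ℕ} [Fact p.Prime] [Fact l.Prime] [CharP K l]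
    {ζ : K} (hζ : IsPrimitiveRoot ζ p) (hpK : (p : K) ≠ 0) (hΩ : ∀ x : Ω, ∃ y, y ^ p = x)
    (hk : ∀ c : k, ∃ r, r ≠ 0 ∧ c ^ l ^ r = c)
    (Φ : Gal(E/K) →* C) (hΦ : IsOpen (Φ.ker : Set Gal(E/K))) (hp : IsPGroup p Φ.range) :
    ∃ (f : Gal(Ω/K) →* C) (S : Set Ω), (∀ α, f α = 1 ↔ ∀ t ∈ S, α t = t) ∧
      ∀ α, ∃ g, f α = Φ g ∧
        (∀ x y : L, α (algebraMap L Ω x) = algebraMap L Ω y →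
          g (algebraMap L E x) = algebraMap L E y) ∧
        ∀ (κ : k →+* Ω) (ε : k →+* E) (n : ℕ), (∀ c, α (κ c) = κ c ^ n) →
          ∀ c, g (ε c) = ε c ^ n := by
  let T := separableClosure L Ω
  let j : T →ₐ[L] E := IsSepClosed.lift
  let jK : T →ₐ[K] E := j.restrictScalars K
  let J : IntermediateField K E := jK.fieldRange
  have hsep : ∀ x : Ω, x ∈ T ↔ IsSeparable K x := fun x => by
    rw [mem_separableClosure_iff]
    exact ⟨IsSeparable.of_algebra_isSeparable_of_isSeparable K, fun h => h.tower_top L⟩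
  have hmem : ∀ (α : Gal(Ω/K)) (x : T), α x ∈ T := fun α x => by
    rw [hsep, IsSeparable, minpoly.algEquiv_eq]
    exact (hsep _).1 x.2
  -- extensions of automorphisms of `Ω` to `E` through `T`
  have hext : ∀ α : Gal(Ω/K), ∃ g : Gal(E/K), ∀ x : T, g (j x) = j ⟨α x, hmem α x⟩ := by
    intro α
    let αT : T ≃ₐ[K] T := AlgEquiv.ofAlgHom
      ((α.toAlgHom.comp ((T.restrictScalars K).val)).codRestrict
        (T.restrictScalars K).toSubalgebra (hmem α))
      ((α.symm.toAlgHom.comp ((T.restrictScalars K).val)).codRestrict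
        (T.restrictScalars K).toSubalgebra (hmem α.symm))
      (by ext x; exact α.apply_symm_apply x) (by ext x; exact α.symm_apply_apply x)
    let _ : Algebra T E := j.toAlgebra
    have : IsScalarTower K T E := IsScalarTower.of_algebraMap_eq fun x => (jK.commutes x).symm
    exact ⟨αT.liftNormal E, fun x => αT.liftNormal_commutes E x⟩
  choose g hg using hext
  -- `J` has no `p`-extensions
  have hJ : ∀ a : J, ∃ b, b ^ p = a := by
    rintro ⟨_, a, rfl⟩
    obtain ⟨b, hb⟩ := hΩ a
    have hp0 : p ≠ 0 := (Fact.out : p.Prime).ne_zero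
    have hbT : b ∈ T := by
      by_cases ha : a = 0
      · have : b = 0 := by
          rw [← pow_eq_zero_iff hp0, hb, ha]; rfl
        exact this ▸ T.zero_mem
      · rw [mem_separableClosure_iff]
        have hs : IsSeparable T b := by
          refine Polynomial.Separable.of_dvd (Polynomial.separable_X_pow_sub_C (n := p) a ?_ ha)
            (minpoly.dvd T b ?_)
          · rw [← map_natCast (algebraMap K T), Ne, FaithfulSMul.algebraMap_eq_zero_iff]
            exact hpK
          · rw [map_sub, map_pow, Polynomial.aeval_X, Polynomial.aeval_C, hb]
            exact sub_self _
        exact IsSeparable.of_algebra_isSeparable_of_isSeparable L hs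
    refine ⟨⟨j ⟨b, hbT⟩, ⟨b, hbT⟩, rfl⟩, Subtype.ext ?_⟩
    change j ⟨b, hbT⟩ ^ p = j a
    rw [← map_pow]
    exact congrArg j (Subtype.ext hb)
  have hN : ∀ h : Gal(E/K), (∀ x : T, h (j x) = j x) → Φ h = 1 := by
    intro h hh
    let r : Gal(E/J) →* Gal(E/K) := AlgEquiv.restrictScalarsHom K
    have h1 : Φ.comp r = 1 := by
      refine monoidHom_galois_eq_one_of_forall_exists_pow_eq
        (hζ.map_of_injective (algebraMap K J).injective) hJ _ ?_ ?_
      · rw [Subgroup.isOpen_galois_iff_exists_finset] at hΦ ⊢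
        obtain ⟨s, hs⟩ := hΦ
        exact ⟨s, fun g hg => hs (r g) hg⟩
      · refine hp.of_injective (Subgroup.inclusion ?_) (Subgroup.inclusion_injective _)
        rintro _ ⟨g, rfl⟩
        exact ⟨r g, rfl⟩
    have hhJ : h ∈ J.fixingSubgroup := by
      rw [IntermediateField.mem_fixingSubgroup_iff]
      rintro _ ⟨x, rfl⟩
      exact hh x
    exact DFunLike.congr_fun h1 (IntermediateField.fixingSubgroupEquiv J ⟨h, hhJ⟩)
  have hmul : ∀ α β, Φ (g (α * β)) = Φ (g α) * Φ (g β) := by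
    intro α β
    rw [← map_mul, ← inv_mul_eq_one, ← map_inv, ← map_mul]
    refine hN _ fun x => ?_
    change (g (α * β)).symm (g α (g β (j x))) = j x
    rw [hg, hg, AlgEquiv.symm_apply_eq, hg]
    rfl
  have hker : (IntermediateField.fixedField Φ.ker).fixingSubgroup = Φ.ker :=
    InfiniteGalois.fixingSubgroup_fixedField ⟨Φ.ker, Φ.ker.isClosed_of_isOpen hΦ⟩
  have hle : IntermediateField.fixedField Φ.ker ≤ J := by
    rw [← InfiniteGalois.fixedField_fixingSubgroup J]
    refine IntermediateField.fixedField_antitone fun h hh => hN h fun x => ?_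
    exact (IntermediateField.mem_fixingSubgroup_iff _ _).1 hh _ ⟨x, rfl⟩
  refine ⟨MonoidHom.mk' (fun α => Φ (g α)) hmul,
    {t | ∃ h : t ∈ T, j ⟨t, h⟩ ∈ IntermediateField.fixedField Φ.ker}, fun α => ?_,
    fun α => ⟨g α, rfl, ?_, ?_⟩⟩
  · have hΦg : Φ (g α) = 1 ↔ ∀ x ∈ IntermediateField.fixedField Φ.ker, g α x = x := by
      rw [← MonoidHom.mem_ker]
      conv_lhs => rw [← hker]
      exact IntermediateField.mem_fixingSubgroup_iff _ _
    rw [MonoidHom.mk'_apply, hΦg]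
    constructor
    · rintro h t ⟨ht, ht'⟩
      have := h _ ht'
      rw [hg] at this
      exact congrArg Subtype.val (j.injective this)
    · intro h x hx
      obtain ⟨⟨t, ht⟩, rfl⟩ := hle hx
      exact (hg α ⟨t, ht⟩).trans (congrArg j (Subtype.ext (h t ⟨ht, hx⟩)))
  · intro x y hxy
    have h1 := hg α (algebraMap L T x)
    rw [j.commutes] at h1
    rw [h1, ← j.commutes]
    exact congrArg j (Subtype.ext hxy)
  · intro κ ε n hn c
    have hl : Fact l.Prime := inferInstance
    have hκT : ∀ c, κ c ∈ T := fun c => by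
      obtain ⟨r, hr, hc⟩ := hk c
      have : CharP L l := charP_of_injective_algebraMap (algebraMap K L).injective l
      rw [mem_separableClosure_iff]
      refine Polynomial.Separable.of_dvd (galois_poly_separable l (l ^ r) (dvd_pow_self l hr))
        (minpoly.dvd L _ ?_)
      rw [map_sub, map_pow, Polynomial.aeval_X, ← map_pow, hc, sub_self]
    let κT : k →+* T := κ.codRestrict T.toSubfield hκT
    let η : k →+* E := (j : T →+* E).comp κT
    let _ : Algebra k E := η.toAlgebra
    obtain ⟨c', hc'⟩ : ∃ c', η c' = ε c := by
      obtain ⟨r, hr, hc⟩ := hk c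
      have hint : IsIntegral k (ε c) := by
        refine ⟨Polynomial.X ^ l ^ r - Polynomial.X, ?_, ?_⟩
        · exact Polynomial.monic_X_pow_sub (by
            rw [Polynomial.degree_X]
            exact_mod_cast Nat.one_lt_pow hr hl.out.one_lt)
        · simp [← map_pow, hc]
      exact minpoly.mem_range_of_degree_eq_one k _
        (IsAlgClosed.degree_eq_one_of_irreducible k (minpoly.irreducible hint))
    rw [← hc']
    refine (hg α (κT c')).trans ?_
    change _ = (j (κT c')) ^ n
    rw [← map_pow]
    exact congrArg j (Subtype.ext (hn c'))

end Transfer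

section MatrixObstruction

open Matrix

theorem one_add_pow_prime_of_nsmul_cube_eq_zero {M : Type*} [Ring M] {p : ℕ} (hp : p.Prime)
    (hodd : p ≠ 2) {A : M} (hA : p • A ^ 3 = 0) :
    (1 + A) ^ p = 1 + p • A + p • ((p - 1) / 2) • A ^ 2 + A ^ p := by
  have hp3 : 3 ≤ p := by have := hp.two_le; omega
  have hch : p.choose 2 = p * ((p - 1) / 2) := by
    rw [Nat.choose_two_right, Nat.mul_div_assoc]
    have := hp.eq_two_or_odd; omega
  rw [add_comm 1 A, (Commute.one_right A).add_pow, Finset.sum_range_succ]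
  obtain ⟨k, rfl⟩ : ∃ k, p = k + 3 := ⟨p - 3, by omega⟩
  simp only [one_pow, mul_one, ← nsmul_eq_mul', Nat.choose_self, one_smul]
  congr 1
  rw [add_comm k 3, Finset.sum_range_add, Finset.sum_eq_zero (s := Finset.range k), add_zero]
  · rw [add_comm k 3] at hch
    simp only [Finset.sum_range_succ, hch, Finset.range_zero, Finset.sum_empty, mul_smul]
    simp
  · intro i hi
    have hi := Finset.mem_range.1 hi
    obtain ⟨m, hm⟩ := hp.dvd_choose_self (k := 3 + i) (by omega) (by omega)
    rw [add_comm k 3] at hm hA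
    rw [hm, mul_comm, mul_smul, pow_add, ← smul_mul_assoc, hA, zero_mul, smul_zero]

theorem smul_mul_eq_of_conj {R M : Type*} [CommRing R] [Ring M] [Algebra R M] {e : R}
    (he : e * e = 0) {X A V Q : M} (hV : V = 1 + e • Q)
    (h : (1 + e • X) * (1 + A) = (1 + A) * V * (1 + e • X)) :
    e • (X * A) = e • (A * X + Q + A * Q) := by
  subst hV
  simp only [mul_add, add_mul, one_mul, mul_one, smul_mul_assoc, mul_smul_comm, smul_smul,
    smul_add, he, zero_smul, add_zero] at h
  have := sub_eq_zero.2 h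
  rw [← sub_eq_zero, ← this]
  simp only [smul_add]
  abel

theorem cube_nilpotent_add_smul {R M : Type*} [CommRing R] [Ring M] [Algebra R M] {e : R}
    (he : e * e = 0) {N W : M} (hN : N * N * N = 0) :
    (N + e • W) ^ 3 = e • (N * N * W + N * W * N + W * N * N) := by
  simp only [pow_succ, pow_zero, mul_add, add_mul, one_mul, smul_mul_assoc, mul_smul_comm,
    smul_smul, smul_add, he, zero_smul, add_zero, zero_add, hN]
  abel

theorem one_add_nilpotent_pow_prime {R M : Type*} [CommRing R] [Ring M] [Algebra R M] {p : ℕ}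
    (hp : p.Prime) (hodd : p ≠ 2) (he : (p : R) * p = 0) {N W B : M} (hN : N * N * N = 0)
    (hB : B = N * N * W + N * W * N + W * N * N) :
    (1 + (N + (p : R) • W)) ^ p =
      1 + (p : R) • (N + (((p - 1) / 2 : ℕ) : R) • (N * N) + (if p = 3 then (1 : R) else 0) • B +
        (if p = 5 then (1 : R) else 0) • (N * N * B)) := by
  have h3 := cube_nilpotent_add_smul (W := W) he hN
  rw [← hB] at h3
  have hz : p • (N + (p : R) • W) ^ 3 = 0 := by
    rw [h3, ← Nat.cast_smul_eq_nsmul R, smul_smul, he, zero_smul]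
  have h1 : (p : R) • (N + (p : R) • W) = (p : R) • N := by
    rw [smul_add, smul_smul, he, zero_smul, add_zero]
  have h2 : (p : R) • (N + (p : R) • W) ^ 2 = (p : R) • (N * N) := by
    rw [sq, ← smul_mul_assoc, h1, smul_mul_assoc, ← mul_smul_comm, h1, mul_smul_comm]
  have h4 : (p : R) • (N + (p : R) • W) ^ 4 = 0 := by
    rw [pow_add _ 2 2, ← smul_mul_assoc, h2, smul_mul_assoc, ← mul_smul_comm, h2, mul_smul_comm,
      ← mul_assoc, hN, zero_mul, smul_zero]
  suffices h : (N + (p : R) • W) ^ p = (p : R) • ((if p = 3 then (1 : R) else 0) • B +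
      (if p = 5 then (1 : R) else 0) • (N * N * B)) by
    rw [one_add_pow_prime_of_nsmul_cube_eq_zero hp hodd hz, h, smul_comm p]
    simp only [← Nat.cast_smul_eq_nsmul R, h1, h2, smul_add]
    rw [smul_comm (p : R) (((p - 1) / 2 : ℕ) : R)]
    abel
  have hp2 := hp.two_le
  have hp4 : p ≠ 4 := by rintro rfl; revert hp; decide
  have hp6 : p ≠ 6 := by rintro rfl; revert hp; decide
  obtain rfl | h5 : p = 3 ∨ 5 ≤ p := by omega
  · simp only [h3]; simp
  obtain rfl | h7 : p = 5 ∨ 7 ≤ p := by omega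
  · rw [pow_add _ 2 3, h3, mul_smul_comm, ← smul_mul_assoc, h2]
    simp
  · obtain ⟨k, hk⟩ : ∃ k, p = 4 + (3 + k) := ⟨p - 7, by omega⟩
    have : (N + (p : R) • W) ^ p = (N + (p : R) • W) ^ (4 + (3 + k)) := by rw [← hk]
    rw [this, pow_add, pow_add _ 3 k, h3, smul_mul_assoc, mul_smul_comm, ← smul_mul_assoc, h4,
      zero_mul, if_neg (by omega), if_neg (by omega)]
    simp

/-- The constraint on the diagonal of the lift `1 + E₁₃ + p • Y` coming from a commuting pair. -/
theorem prime_mul_eq_zero_of_lift {R : Type*} [CommRing R] {p : ℕ} (hp : p.Prime) (hodd : p ≠ 2)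
    (he : (p : R) * p = 0) {e : R} (hee : e * e = 1) {N E Y W X : Matrix (Fin 3) (Fin 3) R}
    (hN : N = !![0, 1, 0; 0, 0, e; 0, 0, 0]) (hE : E = !![0, 0, 1; 0, 0, 0; 0, 0, 0])
    (hTU : (1 + (E + (p : R) • Y)) * (1 + (N + (p : R) • W)) =
      (1 + (N + (p : R) • W)) * (1 + (E + (p : R) • Y)))
    (hST : (1 + (p : R) • X) * (1 + (E + (p : R) • Y)) =
      (1 + (E + (p : R) • Y)) ^ (p + 1) * (1 + (p : R) • X))
    (hSU : (1 + (p : R) • X) * (1 + (N + (p : R) • W)) =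
      (1 + (N + (p : R) • W)) ^ (p + 1) * (1 + (p : R) • X)) :
    (p : R) * (1 + 2 * (if p = 3 then (1 : R) else 0) * e * (2 * Y 1 1 - Y 0 0 - Y 2 2)) = 0 := by
  have hEE : E * E = 0 := by subst hE; ext i j; fin_cases i <;> fin_cases j <;> simp
  have hNE : N * E = 0 := by
    subst hE hN; ext i j; fin_cases i <;> fin_cases j <;> simp
  have hEN : E * N = 0 := by
    subst hE hN; ext i j; fin_cases i <;> fin_cases j <;> simp
  have hNNN : N * N * N = 0 := by
    subst hN; ext i j; fin_cases i <;> fin_cases j <;> simp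
  have h1 : (p : R) • (E * W + Y * N) = (p : R) • (W * E + N * Y) := by
    simp only [mul_add, add_mul, one_mul, mul_one, smul_mul_assoc, mul_smul_comm, smul_smul,
      smul_add, he, zero_smul, add_zero, hNE, hEN] at hTU
    have := sub_eq_zero.2 hTU
    rw [← sub_eq_zero, ← this]
    simp only [smul_add]
    abel
  have h2 := smul_mul_eq_of_conj he
    (one_add_nilpotent_pow_prime hp hodd he (N := E) (W := Y) (by rw [hEE, zero_mul]) rfl)
    (by rw [← pow_succ']; exact hST)
  have h3 := smul_mul_eq_of_conj he
    (one_add_nilpotent_pow_prime hp hodd he (N := N) (W := W) hNNN rfl)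
    (by rw [← pow_succ']; exact hSU)
  have hred : ∀ A Z W : Matrix (Fin 3) (Fin 3) R, (p : R) • (Z * (A + (p : R) • W)) =
      (p : R) • (Z * A) := by
    intro A Z W
    rw [mul_add, mul_smul_comm, smul_add, smul_smul, he, zero_smul, add_zero]
  have hred' : ∀ A Z W : Matrix (Fin 3) (Fin 3) R, (p : R) • ((A + (p : R) • W) * Z) =
      (p : R) • (A * Z) := by
    intro A Z W
    rw [add_mul, smul_mul_assoc, smul_add, smul_smul, he, zero_smul, add_zero]
  rw [smul_add, smul_add, hred, hred', hred', ← smul_add, ← smul_add] at h2 h3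
  rw [hEE] at h2
  generalize (if p = 3 then (1 : R) else 0) = d at *
  generalize (if p = 5 then (1 : R) else 0) = f at *
  generalize (((p - 1) / 2 : ℕ) : R) = m at *
  generalize (p : R) = π at *
  clear hTU hST hSU hred hred' hEE hNE hEN hNNN
  subst hN hE
  rw [Matrix.eta_fin_three Y, Matrix.eta_fin_three W, Matrix.eta_fin_three X] at *
  generalize X 0 0 = x00, X 0 1 = x01, X 0 2 = x02, X 1 0 = x10, X 1 1 = x11, X 1 2 = x12,
    X 2 0 = x20, X 2 1 = x21, X 2 2 = x22 at *
  generalize Y 0 0 = y00, Y 0 1 = y01, Y 0 2 = y02, Y 1 0 = y10, Y 1 1 = y11, Y 1 2 = y12,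
    Y 2 0 = y20, Y 2 1 = y21, Y 2 2 = y22 at *
  generalize W 0 0 = w00, W 0 1 = w01, W 0 2 = w02, W 1 0 = w10, W 1 1 = w11, W 1 2 = w12,
    W 2 0 = w20, W 2 1 = w21, W 2 2 = w22 at *
  have e1 := fun i j => congrFun (congrFun h1 i) j
  have e2 := fun i j => congrFun (congrFun h2 i) j
  have e3 := fun i j => congrFun (congrFun h3 i) j
  have a00 := e1 0 0
  have a10 := e1 1 0
  have a11 := e1 1 1
  have a22 := e1 2 2
  have a01 := e1 0 1
  have a12 := e1 1 2
  have b02 := e2 0 2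
  have b12 := e2 1 2
  have b22 := e2 2 2
  have b01 := e2 0 1
  have b00 := e2 0 0
  have c01 := e3 0 1
  have c12 := e3 1 2
  have c00 := e3 0 0
  have c11 := e3 1 1
  have c22 := e3 2 2
  clear h1 h2 h3 e1 e2 e3
  simp at a01 a10 a12 b01 b02 c01 c12 c22
  simp only [Matrix.of_apply, Matrix.cons_val_zero, Matrix.cons_val_one, Matrix.cons_val]
  clear a00 a11 a22 b12 b22 b00 c00 c11 he
  grind

theorem Matrix.exists_eq_add_smul_of_map_castHom_eq {p : ℕ} {n : Type*}
    {A B : Matrix n n (ZMod (p ^ 2))}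
    (h : A.map (ZMod.castHom (dvd_pow_self p two_ne_zero) (ZMod p)) =
      B.map (ZMod.castHom (dvd_pow_self p two_ne_zero) (ZMod p))) :
    ∃ Y : Matrix n n (ZMod (p ^ 2)), A = B + (p : ZMod (p ^ 2)) • Y := by
  have key : ∀ i j, ∃ y, A i j = B i j + (p : ZMod (p ^ 2)) * y := by
    intro i j
    have h1 : ZMod.castHom (dvd_pow_self p two_ne_zero) (ZMod p) (A i j - B i j) = 0 := by
      rw [map_sub, sub_eq_zero]
      exact congrFun (congrFun h i) j
    obtain ⟨z, hz⟩ := ZMod.intCast_surjective (A i j - B i j)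
    rw [← hz, map_intCast, ZMod.intCast_zmod_eq_zero_iff_dvd] at h1
    obtain ⟨w, rfl⟩ := h1
    exact ⟨w, by rw [← sub_eq_iff_eq_add', ← hz]; push_cast; rfl⟩
  choose Y hY using key
  exact ⟨Matrix.of Y, by ext i j; simp [hY]⟩

theorem one_add_nilpotent_pow_prime_sq {R M : Type*} [CommRing R] [Ring M] [Algebra R M] {p : ℕ}
    (hp : p.Prime) (hodd : p ≠ 2) (he : (p : R) * p = 0) {N W : M} (hN : N * N * N = 0) :
    (1 + (N + (p : R) • W)) ^ (p ^ 2) = 1 := by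
  rw [sq, pow_mul, one_add_nilpotent_pow_prime hp hodd he hN rfl]
  have := one_add_nilpotent_pow_prime hp hodd he (N := (0 : M))
    (W := N + (((p - 1) / 2 : ℕ) : R) • (N * N) +
    (if p = 3 then (1 : R) else 0) • (N * N * W + N * W * N + W * N * N) +
    (if p = 5 then (1 : R) else 0) • (N * N * (N * N * W + N * W * N + W * N * N))) (by simp) rfl
  simpa using this

theorem pow_eq_pow_of_modEq_of_pow_eq_one {M : Type*} [Monoid M] {x : M} {n a b : ℕ} (h : x ^ n = 1)
    (hab : a ≡ b [MOD n]) : x ^ a = x ^ b := by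
  rw [pow_eq_pow_mod a h, pow_eq_pow_mod b h, hab]

theorem false_of_lift_commuting_pairs {p l : ℕ} (hp : p.Prime) (hodd : p ≠ 2)
    (hl : l ≡ p + 1 [MOD p ^ 2]) {t : Matrix (Fin 3) (Fin 3) (ZMod (p ^ 2))}
    (ht : t.map (ZMod.castHom (dvd_pow_self p two_ne_zero) (ZMod p)) =
      !![1, 0, 1; 0, 1, 0; 0, 0, 1])
    (h : ∀ e : ℤ, e * e = 1 → ∃ u s : Matrix (Fin 3) (Fin 3) (ZMod (p ^ 2)),
      u.map (ZMod.castHom (dvd_pow_self p two_ne_zero) (ZMod p)) =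
        !![1, 1, 0; 0, 1, (e : ZMod p); 0, 0, 1] ∧
      s.map (ZMod.castHom (dvd_pow_self p two_ne_zero) (ZMod p)) = 1 ∧
      t * u = u * t ∧ s * t = t ^ l * s ∧ s * u = u ^ l * s) : False := by
  have he : (p : ZMod (p ^ 2)) * p = 0 := by
    rw [← Nat.cast_mul, ← sq]; exact ZMod.natCast_self _
  obtain ⟨Y, hY⟩ : ∃ Y, t = !![1, 0, 1; 0, 1, 0; 0, 0, 1] + (p : ZMod (p ^ 2)) • Y := by
    refine Matrix.exists_eq_add_smul_of_map_castHom_eq (ht.trans ?_)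
    ext i j; fin_cases i <;> fin_cases j <;> simp
  have hE : !![1, 0, 1; 0, 1, 0; 0, 0, 1] = (1 : Matrix (Fin 3) (Fin 3) (ZMod (p ^ 2))) +
      !![0, 0, 1; 0, 0, 0; 0, 0, 0] := by
    ext i j; fin_cases i <;> fin_cases j <;> simp
  rw [hE, add_assoc] at hY
  have key : ∀ e : ℤ, e * e = 1 → (p : ZMod (p ^ 2)) * (1 + 2 * (if p = 3 then 1 else 0) * e *
      (2 * Y 1 1 - Y 0 0 - Y 2 2)) = 0 := by
    intro e hee
    obtain ⟨u, s, hu, hs, htu, hst, hsu⟩ := h e hee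
    obtain ⟨W, hW⟩ : ∃ W, u = !![1, 1, 0; 0, 1, (e : ZMod (p ^ 2)); 0, 0, 1] +
        (p : ZMod (p ^ 2)) • W := by
      refine Matrix.exists_eq_add_smul_of_map_castHom_eq (hu.trans ?_)
      ext i j; fin_cases i <;> fin_cases j <;> simp
    have hN : !![1, 1, 0; 0, 1, (e : ZMod (p ^ 2)); 0, 0, 1] = 1 +
        !![0, 1, 0; 0, 0, (e : ZMod (p ^ 2)); 0, 0, 0] := by
      ext i j; fin_cases i <;> fin_cases j <;> simp
    rw [hN, add_assoc] at hW
    obtain ⟨X, hX⟩ : ∃ X, s = 1 + (p : ZMod (p ^ 2)) • X := by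
      refine Matrix.exists_eq_add_smul_of_map_castHom_eq (hs.trans ?_)
      ext i j; fin_cases i <;> fin_cases j <;> simp
    have htp : t ^ p ^ 2 = 1 := by
      rw [hY]
      refine one_add_nilpotent_pow_prime_sq hp hodd he ?_
      ext i j; fin_cases i <;> fin_cases j <;> simp
    have hup : u ^ p ^ 2 = 1 := by
      rw [hW]
      refine one_add_nilpotent_pow_prime_sq hp hodd he ?_
      ext i j; fin_cases i <;> fin_cases j <;> simp
    rw [pow_eq_pow_of_modEq_of_pow_eq_one htp hl, hX, hY] at hst
    rw [pow_eq_pow_of_modEq_of_pow_eq_one hup hl, hX, hW] at hsu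
    rw [hY, hW] at htu
    exact prime_mul_eq_zero_of_lift hp hodd he
      (by exact_mod_cast congrArg (Int.cast : ℤ → ZMod (p ^ 2)) hee) rfl rfl htu hst hsu
  have h1 := key 1 rfl
  have h2 := key (-1) rfl
  have h3 : ((2 * p : ℕ) : ZMod (p ^ 2)) = 0 := by
    push_cast at h1 h2 ⊢
    linear_combination h1 + h2
  rw [ZMod.natCast_eq_zero_iff, sq] at h3
  have := Nat.le_of_dvd (by decide) (Nat.dvd_of_mul_dvd_mul_right hp.pos h3)
  have := hp.two_le
  omega

end MatrixObstruction

section Laurent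

open Multiplicative

/-- The embedding of the field of Laurent series over `L` into the field of Hahn series with real
exponents over an extension `E` of `L`. -/
noncomputable def HahnSeries.laurentEmb (L E : Type*) [Field L] [Field E] [Algebra L E] :
    HahnSeries ℤ L →+* HahnSeries ℝ E :=
  (HahnSeries.embDomainRingHom (Int.castAddHom ℝ) Int.cast_injective
    (fun _ _ => Int.cast_le)).comp (HahnSeries.twist (algebraMap L E) 1)

theorem HahnSeries.coeff_laurentEmb_intCast {L E : Type*} [Field L] [Field E] [Algebra L E]
    (y : HahnSeries ℤ L) (n : ℤ) :
    (HahnSeries.laurentEmb L E y).coeff n = algebraMap L E (y.coeff n) := by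
  refine (HahnSeries.embDomain_coeff (a := n)).trans ?_
  simp

theorem HahnSeries.coeff_laurentEmb_of_notMem {L E : Type*} [Field L] [Field E] [Algebra L E]
    (y : HahnSeries ℤ L) {r : ℝ} (hr : r ∉ Set.range ((↑) : ℤ → ℝ)) :
    (HahnSeries.laurentEmb L E y).coeff r = 0 :=
  HahnSeries.embDomain_of_notMem_range hr

theorem HahnSeries.twistEquiv_laurentEmb {L E : Type*} [Field L] [Field E] [Algebra L E]
    {a : E ≃+* E} {b : L ≃+* L} {χ : Multiplicative ℝ →* Eˣ} {ψ : Multiplicative ℤ →* Lˣ}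
    (hab : ∀ x, a (algebraMap L E x) = algebraMap L E (b x))
    (hχ : ∀ n : ℤ, (χ (ofAdd (n : ℝ)) : E) = algebraMap L E (ψ (ofAdd n))) (y : HahnSeries ℤ L) :
    HahnSeries.twistEquiv a χ (HahnSeries.laurentEmb L E y) =
      HahnSeries.laurentEmb L E (HahnSeries.twistEquiv b ψ y) := by
  ext r
  rw [HahnSeries.coeff_twistEquiv]
  by_cases hr : r ∈ Set.range ((↑) : ℤ → ℝ)
  · obtain ⟨n, rfl⟩ := hr
    rw [HahnSeries.coeff_laurentEmb_intCast, HahnSeries.coeff_laurentEmb_intCast,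
      HahnSeries.coeff_twistEquiv, hab, hχ, map_mul]
  · rw [HahnSeries.coeff_laurentEmb_of_notMem _ hr, HahnSeries.coeff_laurentEmb_of_notMem _ hr,
      map_zero, zero_mul]

/-- The action of `U × Z` on Laurent series over `L`, where `U` acts on the coefficients and `Z`
scales the uniformizer through the character `b`. -/
noncomputable def HahnSeries.laurentAut {U Z L : Type*} [Group U] [Group Z] [Field L]
    [MulSemiringAction U L] (b : Z →* Lˣ) (hb : ∀ (u : U) z, u • (b z : L) = b z) :
    U × Z →* RingAut (HahnSeries ℤ L) :=
  MonoidHom.mk'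
    (fun g => HahnSeries.twistEquiv (MulSemiringAction.toRingEquiv U L g.1) (zpowersHom _ (b g.2)))
    (by
      rintro ⟨u, z⟩ ⟨u', z'⟩
      refine RingEquiv.ext fun x => HahnSeries.ext (funext fun n => ?_)
      rw [RingAut.mul_apply]
      have hbn : u • ((b z' : L) ^ n) = b z' ^ n := by
        rw [← MulSemiringAction.toRingEquiv_apply_apply, map_zpow₀,
          MulSemiringAction.toRingEquiv_apply_apply, hb]
      simp only [HahnSeries.coeff_twistEquiv, MulSemiringAction.toRingEquiv_apply_apply,
        zpowersHom_apply, toAdd_ofAdd, Prod.mk_mul_mk, map_mul, mul_zpow, Units.val_mul,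
        Units.val_zpow_eq_zpow_val, RingAut.mul_apply, hbn]
      ring)

theorem HahnSeries.laurentAut_apply {U Z L : Type*} [Group U] [Group Z] [Field L]
    [MulSemiringAction U L] (b : Z →* Lˣ) (hb : ∀ (u : U) z, u • (b z : L) = b z) (g : U × Z) :
    HahnSeries.laurentAut b hb g = HahnSeries.twistEquiv
      (MulSemiringAction.toRingEquiv U L g.1) (zpowersHom _ (b g.2)) := rfl

theorem HahnSeries.laurentAut_injective {U Z L : Type*} [Group U] [Group Z] [Field L]
    [MulSemiringAction U L] [FaithfulSMul U L] (b : Z →* Lˣ)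
    (hb : ∀ (u : U) z, u • (b z : L) = b z) (hbi : Function.Injective b) :
    Function.Injective (HahnSeries.laurentAut b hb) := by
  refine (injective_iff_map_eq_one _).2 ?_
  rintro ⟨u, z⟩ h
  have key : ∀ (x : HahnSeries ℤ L) n, u • (HahnSeries.coeff x n) * (b z : L) ^ n =
      x.coeff n := fun x n => by
    have := congrArg (fun y => HahnSeries.coeff y n) (RingEquiv.congr_fun h x)
    simpa [HahnSeries.laurentAut_apply] using this
  refine Prod.ext (FaithfulSMul.eq_of_smul_eq_smul (α := L) fun x => ?_)
    ((injective_iff_map_eq_one _).1 hbi _ (Units.ext ?_))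
  · simpa using key (HahnSeries.single 0 x) 0
  · simpa using key (HahnSeries.single 1 1) 1

end Laurent

section Realization

theorem exists_field_galois_mulEquiv {G M : Type} [Group G] [Finite G] [Field M]
    {ψ : G →* RingAut M} (hψ : Function.Injective ψ) :
    ∃ (F : Type) (_ : Field F) (_ : Algebra F M) (_ : FiniteDimensional F M) (_ : IsGalois F M)
      (e : G ≃* Gal(M/F)), ∀ g x, e g x = ψ g x := by
  let _ : MulSemiringAction G M := MulSemiringAction.compHom M ψ
  have : FaithfulSMul G M := ⟨fun h => hψ (RingEquiv.ext h)⟩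
  exact ⟨FixedPoints.subfield G M, inferInstance, inferInstance, inferInstance,
    { }, FixedPoints.toAlgAutMulEquiv G M, fun _ _ => rfl⟩

theorem exists_galois_monoidHom_restrict {G F M A : Type*} [Group G] [Field F] [Field M] [Field A]
    [Algebra F M] [Algebra F A] [Algebra M A] [IsScalarTower F M A] [FiniteDimensional F M]
    [Normal F M] [Algebra.IsIntegral F A] (e : G ≃* Gal(M/F)) :
    ∃ q : Gal(A/F) →* G, IsOpen (q.ker : Set Gal(A/F)) ∧
      ∀ s g, (∀ x, s (algebraMap M A x) = algebraMap M A (e g x)) → q s = g := by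
  have hq : ∀ s g, (∀ x, s (algebraMap M A x) = algebraMap M A (e g x)) →
      e.symm (AlgEquiv.restrictNormalHom M s) = g := by
    intro s g h
    refine (MulEquiv.symm_apply_eq _).2 (AlgEquiv.ext fun x => (algebraMap M A).injective ?_)
    exact (AlgEquiv.restrictNormal_commutes s M x).trans (h x)
  refine ⟨e.symm.toMonoidHom.comp (AlgEquiv.restrictNormalHom M), ?_, hq⟩
  let bs := Module.finBasis F M
  classical
  rw [Subgroup.isOpen_galois_iff_exists_finset]
  refine ⟨Finset.univ.image fun j => algebraMap M A (bs j), fun s hs => hq s 1 fun x => ?_⟩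
  have h1 : s.toAlgHom.comp (IsScalarTower.toAlgHom F M A) = IsScalarTower.toAlgHom F M A := by
    refine AlgHom.toLinearMap_injective (bs.ext fun j => ?_)
    exact hs _ (Finset.mem_image_of_mem _ (Finset.mem_univ j))
  rw [map_one]
  exact DFunLike.congr_fun h1 x

end Realization

section Laurent

open Multiplicative

theorem AlgebraicClosure.exists_pow_card_pow_eq {l : ℕ} [Fact l.Prime]
    (c : AlgebraicClosure (ZMod l)) : ∃ r, r ≠ 0 ∧ c ^ l ^ r = c := by
  have hc : IsIntegral (ZMod l) c := Algebra.IsIntegral.isIntegral c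
  let D := IntermediateField.adjoin (ZMod l) {c}
  have : FiniteDimensional (ZMod l) D := IntermediateField.adjoin.finiteDimensional hc
  have : Finite D := Module.finite_of_finite (ZMod l)
  cases nonempty_fintype D
  have hcard : Fintype.card D = l ^ Module.finrank (ZMod l) D := by
    rw [Module.card_eq_pow_finrank (K := ZMod l), ZMod.card]
  have h := FiniteField.pow_card (⟨c, IntermediateField.mem_adjoin_simple_self _ c⟩ : D)
  rw [hcard] at h
  exact ⟨_, Module.finrank_pos.ne', congrArg Subtype.val h⟩

theorem exists_field_commuting_lift {p l : ℕ} [Fact p.Prime] [Fact l.Prime] {ζ : ZMod l}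
    (hζ : IsPrimitiveRoot ζ p) {Z K L E : Type} [Group Z] [Finite Z] [Field K] [Field L] [Field E]
    [Algebra (ZMod l) L] [Algebra K L] [Algebra K E] [Algebra L E] [IsScalarTower K L E]
    [FiniteDimensional K L] [IsGalois K L] [IsGalois K E] [IsSepClosed E]
    (ε : AlgebraicClosure (ZMod l) →+* E) {b : Z →* (ZMod l)ˣ} (hb : Function.Injective b)
    {z : Z} (hz : (b z : ZMod l) = ζ) :
    ∃ (F : Type) (_ : Field F) (q : Gal(SeparableClosure F/F) →* Gal(L/K) × Z),
      IsOpen (q.ker : Set Gal(SeparableClosure F/F)) ∧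
      ∀ {C : Type} [Group C] [Finite C] (Φ : Gal(SeparableClosure F/F) →* C),
        IsOpen (Φ.ker : Set Gal(SeparableClosure F/F)) → IsPGroup p Φ.range →
        ∃ (Ψ : Gal(E/K) →* C) (t : C), IsOpen (Ψ.ker : Set Gal(E/K)) ∧
          (∃ g, t = Φ g ∧ q g = (1, z)) ∧
          (∀ α, ∃ g, Ψ α = Φ g ∧ ∀ u : Gal(L/K),
            (∀ x, α (algebraMap L E x) = algebraMap L E (u x)) → q g = (u, 1)) ∧
          ∀ (α : Gal(E/K)) (n : ℕ), (∀ c, α (ε c) = ε c ^ n) → Ψ α * t = t ^ n * Ψ α := by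
  have : NeZero p := ⟨(Fact.out : p.Prime).ne_zero⟩
  have hpl : (p : ZMod l) ≠ 0 := hζ.neZero'.out
  have hι : Function.Injective (algebraMap (ZMod l) L) := (algebraMap (ZMod l) L).injective
  let bL : Z →* Lˣ := (Units.map (algebraMap (ZMod l) L : ZMod l →* L)).comp b
  have hbL : ∀ (u : Gal(L/K)) z, u • (bL z : L) = bL z := fun u z =>
    RingHom.congr_fun (Subsingleton.elim
      ((u : L →+* L).comp (algebraMap (ZMod l) L)) (algebraMap (ZMod l) L)) _
  have hbLi : Function.Injective bL := (Units.map_injective hι).comp hb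
  obtain ⟨F, _, _, _, _, e, he⟩ := exists_field_galois_mulEquiv
    (HahnSeries.laurentAut_injective bL hbL hbLi)
  let M := HahnSeries ℤ L
  let A := SeparableClosure F
  let i : M →ₐ[F] A := IsSepClosed.lift
  let _ : Algebra M A := i.toAlgebra
  have : IsScalarTower F M A := IsScalarTower.of_algebraMap_eq fun x => (i.commutes x).symm
  obtain ⟨q, hqo, hq⟩ := exists_galois_monoidHom_restrict (A := A) e
  refine ⟨F, inferInstance, q, hqo, fun {C} _ _ Φ hΦ hp => ?_⟩
  let j := HahnSeries.laurentEmb L E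
  let Ω := HahnSeries ℝ E
  let _ : Algebra M Ω := j.toAlgebra
  let _ : Algebra F Ω := (j.comp (algebraMap F M)).toAlgebra
  have : IsScalarTower F M Ω := IsScalarTower.of_algebraMap_eq fun _ => rfl
  have hpE : (p : E) ≠ 0 := by
    have := ((algebraMap L E).injective.comp hι).ne hpl
    simpa using this
  have : NeZero (p : E) := ⟨hpE⟩
  have hΩ : ∀ x : Ω, ∃ y, y ^ p = x := HahnSeries.exists_pow_eq hpE
    (fun a => IsSepClosed.exists_pow_nat_eq a p) fun a => ⟨a / p, by
      have : (p : ℝ) ≠ 0 := by exact_mod_cast (Fact.out : p.Prime).ne_zero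
      rw [nsmul_eq_mul]; field_simp⟩
  have hML : CharP M l := charP_of_injective_ringHom
    (f := (HahnSeries.C (Γ := ℤ)).comp (algebraMap (ZMod l) L)) (RingHom.injective _) l
  have hFl : CharP F l := (RingHom.charP_iff (algebraMap F M) (algebraMap F M).injective l).2 hML
  have hζF : IsPrimitiveRoot (ZMod.castHom (dvd_refl l) F ζ) p :=
    hζ.map_of_injective (RingHom.injective _)
  have hpF : (p : F) ≠ 0 := by
    have := (ZMod.castHom (dvd_refl l) F).injective.ne hpl
    simpa using this
  obtain ⟨f, S, hfS, hf⟩ := exists_monoidHom_of_isSepClosed (L := M) (l := l) hζF hpF hΩ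
    AlgebraicClosure.exists_pow_card_pow_eq Φ hΦ hp
  -- the action of automorphisms of `Ω` on `M`
  have hact : ∀ (g : Gal(L/K) × Z) (a : E ≃+* E) (χ : Multiplicative ℝ →* Eˣ),
      (∀ x, a (algebraMap L E x) = algebraMap L E (g.1 x)) →
      (∀ n : ℤ, (χ (ofAdd (n : ℝ)) : E) = algebraMap L E (bL g.2 ^ n : Lˣ)) →
      ∀ y : M, HahnSeries.twistEquiv a χ (j y) = j (e g y) := by
    intro g a χ ha hχ y
    rw [he, HahnSeries.laurentAut_apply]
    exact HahnSeries.twistEquiv_laurentEmb ha hχ y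
  have hcoef : ∀ (α : Gal(E/K)) (u : Gal(L/K)),
      (∀ x, α (algebraMap L E x) = algebraMap L E (u x)) →
      ∀ y : M, HahnSeries.twistEquiv (α : E ≃+* E) 1 (j y) = j (e (u, 1) y) :=
    fun α u h => hact (u, 1) α 1 h fun n => by simp
  let coef : Gal(E/K) →* Gal(Ω/F) := MonoidHom.mk'
    (fun α => AlgEquiv.ofRingEquiv (f := HahnSeries.twistEquiv (α : E ≃+* E) 1) fun x => by
      refine (hcoef α _ (fun y => (AlgEquiv.restrictNormal_commutes α L y).symm) _).trans ?_
      rw [AlgEquiv.commutes]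
      rfl)
    fun α β => by
      refine AlgEquiv.ext fun x => HahnSeries.ext (funext fun γ => ?_)
      change α (β (HahnSeries.coeff x γ)) * ((1 : Eˣ) : E) =
        α (β (HahnSeries.coeff x γ) * ((1 : Eˣ) : E)) * ((1 : Eˣ) : E)
      simp
  have hζk : IsPrimitiveRoot (algebraMap (ZMod l) (AlgebraicClosure (ZMod l)) ζ) p :=
    hζ.map_of_injective (RingHom.injective _)
  have hlin : LinearIndependent ℤ fun _ : Unit => (1 : ℝ) :=
    LinearIndependent.of_subsingleton () one_ne_zero
  obtain ⟨χ, hχ⟩ := exists_character hlin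
    fun _ => Units.mk0 _ (hζk.ne_zero (Fact.out : p.Prime).ne_zero)
  let χE : Multiplicative ℝ →* Eˣ :=
    (Units.map (ε : AlgebraicClosure (ZMod l) →* E)).comp χ
  have hχE : ∀ n : ℤ, (χE (ofAdd (n : ℝ)) : E) = algebraMap L E (bL z ^ n : Lˣ) := by
    intro n
    have h1 : (ε (algebraMap (ZMod l) _ ζ)) = algebraMap L E (bL z : L) := by
      rw [← hz]
      exact RingHom.congr_fun (Subsingleton.elim (ε.comp (algebraMap (ZMod l) _))
        ((algebraMap L E).comp (algebraMap (ZMod l) L))) _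
    have h2 : χ (ofAdd (n : ℝ)) = χ (ofAdd 1) ^ n := by
      rw [← map_zpow, ← ofAdd_zsmul, zsmul_one]
    have h3 : (χE (ofAdd (n : ℝ)) : E) = ε (χ (ofAdd (n : ℝ)) : (AlgebraicClosure (ZMod l))ˣ) := rfl
    rw [h3, h2, hχ (), Units.val_zpow_eq_zpow_val, map_zpow₀, Units.val_zpow_eq_zpow_val, map_zpow₀,
      ← h1, Units.val_mk0]
  have hτM := hact (1, z) (RingEquiv.refl E) χE (fun _ => rfl) hχE
  let τ : Gal(Ω/F) := AlgEquiv.ofRingEquiv (f := HahnSeries.twistEquiv (RingEquiv.refl E) χE)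
    fun x => by
      refine (hτM _).trans ?_
      rw [AlgEquiv.commutes]
      rfl
  have hq' : ∀ (a : Gal(Ω/F)) (g : Gal(L/K) × Z), (∀ y : M, a (j y) = j (e g y)) →
      ∃ s, f a = Φ s ∧ q s = g := by
    intro a g h
    obtain ⟨s, hs, hs', -⟩ := hf a
    exact ⟨s, hs, hq s g fun x => hs' x _ (h x)⟩
  have hcoeff : ∀ (α : Gal(E/K)) (x : Ω) (γ : ℝ),
      HahnSeries.coeff (coef α x) γ = α (HahnSeries.coeff x γ) := fun α x γ =>
    (HahnSeries.coeff_twistEquiv (α : E ≃+* E) 1 x γ).trans (mul_one _)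
  refine ⟨f.comp coef, f τ, ?_, hq' _ _ hτM, fun α => ?_, fun α n hα => ?_⟩
  · refine Subgroup.isOpen_of_isClosed_of_finiteIndex _ ?_
    let D := IntermediateField.adjoin K {y : E | ∃ x ∈ S, ∃ γ, HahnSeries.coeff x γ = y}
    have hD : (f.comp coef).ker = D.fixingSubgroup := by
      ext α
      rw [MonoidHom.mem_ker, MonoidHom.comp_apply, hfS, IntermediateField.mem_fixingSubgroup_iff]
      constructor
      · intro h y hy
        induction hy using IntermediateField.adjoin_induction with
        | mem y hy =>
          obtain ⟨x, hx, γ, rfl⟩ := hy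
          exact (hcoeff α x γ).symm.trans (congrArg (fun x => HahnSeries.coeff x γ) (h x hx))
        | algebraMap c => exact α.commutes c
        | add x y _ _ hx hy => rw [map_add, hx, hy]
        | inv x _ hx => rw [map_inv₀, hx]
        | mul x y _ _ hx hy => rw [map_mul, hx, hy]
      · intro h x hx
        refine HahnSeries.ext (funext fun γ => ?_)
        rw [hcoeff]
        exact h _ (IntermediateField.subset_adjoin _ _ ⟨x, hx, γ, rfl⟩)
    rw [hD]
    exact InfiniteGalois.fixingSubgroup_isClosed D
  · obtain ⟨s, hs, hs', -⟩ := hf (coef α)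
    exact ⟨s, hs, fun u hu => hq s _ fun x => hs' x _ (hcoef α u hu x)⟩
  · have h1 : coef α * τ = τ ^ n * coef α := by
      have hτ : ∀ (m : ℕ) (x : Ω) (γ : ℝ), HahnSeries.coeff ((τ ^ m) x) γ =
          HahnSeries.coeff x γ * (χE (ofAdd γ) : E) ^ m := by
        intro m
        induction m with
        | zero => intro x γ; rw [pow_zero, pow_zero, mul_one]; rfl
        | succ m ih =>
          intro x γ
          rw [pow_succ, AlgEquiv.mul_apply, ih, pow_succ']
          exact (mul_assoc _ _ _)
      refine AlgEquiv.ext fun x => HahnSeries.ext (funext fun γ => ?_)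
      rw [AlgEquiv.mul_apply, AlgEquiv.mul_apply, hτ, hcoeff, hcoeff]
      refine (map_mul α (HahnSeries.coeff x γ) _).trans (congrArg _ ?_)
      exact hα _
    rw [MonoidHom.comp_apply, ← map_mul, h1, map_mul, map_pow]

end Laurent

section Realization

theorem FractionRing.ringHom_ext_mvPolynomial {ι S : Type*} {l : ℕ} [Fact l.Prime] [Field S]
    {f g : FractionRing (MvPolynomial ι (ZMod l)) →+* S}
    (h : ∀ i, f (algebraMap (MvPolynomial ι (ZMod l)) _ (MvPolynomial.X i)) =
      g (algebraMap (MvPolynomial ι (ZMod l)) _ (MvPolynomial.X i))) : f = g := by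
  refine IsLocalization.ringHom_ext (nonZeroDivisors (MvPolynomial ι (ZMod l)))
    (MvPolynomial.ringHom_ext (fun c => ?_) h)
  exact RingHom.congr_fun (Subsingleton.elim (α := ZMod l →+* S)
    ((f.comp (algebraMap _ _)).comp MvPolynomial.C)
    ((g.comp (algebraMap _ _)).comp MvPolynomial.C)) c

theorem FractionRing.exists_renameAut {U ι : Type*} [Group U] {l : ℕ} [Fact l.Prime]
    {a : U →* Equiv.Perm ι} (ha : Function.Injective a) :
    ∃ ψ : U →* RingAut (FractionRing (MvPolynomial ι (ZMod l))), Function.Injective ψ ∧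
      ∀ u i, ψ u (algebraMap (MvPolynomial ι (ZMod l)) _ (MvPolynomial.X i)) =
        algebraMap (MvPolynomial ι (ZMod l)) _ (MvPolynomial.X (a u i)) := by
  let r : U → RingAut (FractionRing (MvPolynomial ι (ZMod l))) := fun u =>
    IsFractionRing.ringEquivOfRingEquiv (MvPolynomial.renameEquiv (ZMod l) (a u)).toRingEquiv
  have hr : ∀ u i, r u (algebraMap (MvPolynomial ι (ZMod l)) _ (MvPolynomial.X i)) =
        algebraMap (MvPolynomial ι (ZMod l)) _ (MvPolynomial.X (a u i)) := fun u i => by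
    simp [r]
  refine ⟨MonoidHom.mk' r fun u v => ?_, ?_, hr⟩
  · have : RingEquiv.toRingHom (r (u * v)) =
        (RingEquiv.toRingHom (r u)).comp (RingEquiv.toRingHom (r v)) :=
      FractionRing.ringHom_ext_mvPolynomial fun i => by
        refine (hr _ i).trans (Eq.symm ?_)
        refine (congrArg (r u) (hr v i)).trans ?_
        rw [hr, map_mul, Equiv.Perm.mul_apply]
    exact RingEquiv.ext (RingHom.congr_fun this)
  · refine (injective_iff_map_eq_one _).2 fun u hu => (injective_iff_map_eq_one _).1 ha _ ?_
    refine Equiv.ext fun i => MvPolynomial.X_injective (R := ZMod l) ?_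
    refine IsFractionRing.injective (MvPolynomial ι (ZMod l))
      (FractionRing (MvPolynomial ι (ZMod l))) ?_
    rw [← hr]
    exact RingEquiv.congr_fun hu _

theorem exists_field_lift_relations {p l : ℕ} [Fact p.Prime] [Fact l.Prime] {ζ : ZMod l}
    (hζ : IsPrimitiveRoot ζ p) {U Z ι : Type} [Group U] [Finite U] [Group Z] [Finite Z]
    [Countable ι] {a : U →* Equiv.Perm ι} (ha : Function.Injective a)
    {b : Z →* (ZMod l)ˣ} (hb : Function.Injective b) {z : Z} (hz : (b z : ZMod l) = ζ) :
    ∃ (F : Type) (_ : Field F) (q : Gal(SeparableClosure F/F) →* U × Z),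
      IsOpen (q.ker : Set Gal(SeparableClosure F/F)) ∧
      ∀ {C : Type} [Group C] [Finite C] (Φ : Gal(SeparableClosure F/F) →* C),
        IsOpen (Φ.ker : Set Gal(SeparableClosure F/F)) → IsPGroup p Φ.range →
        ∃ t : C, (∃ g, t = Φ g ∧ q g = (1, z)) ∧ ∀ υ : U, υ ^ p = 1 →
          ∃ u s : C, (∃ g, u = Φ g ∧ q g = (υ, 1)) ∧ (∃ g, s = Φ g ∧ q g = (1, 1)) ∧
            t * u = u * t ∧ s * t = t ^ l * s ∧ s * u = u ^ l * s := by
  have : NeZero p := ⟨(Fact.out : p.Prime).ne_zero⟩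
  have hpl : (p : ZMod l) ≠ 0 := hζ.neZero'.out
  obtain ⟨ψ, hψ, hψX⟩ := FractionRing.exists_renameAut (l := l) ha
  obtain ⟨K, _, _, _, _, e, he⟩ := exists_field_galois_mulEquiv hψ
  let L := FractionRing (MvPolynomial ι (ZMod l))
  let E := SeparableClosure L
  let _ : Algebra K E := ((algebraMap L E).comp (algebraMap K L)).toAlgebra
  have : IsScalarTower K L E := IsScalarTower.of_algebraMap_eq fun _ => rfl
  have : Algebra.IsSeparable K E := Algebra.IsSeparable.trans K L E
  have : IsSepClosure K E := ⟨inferInstance, inferInstance⟩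
  have : IsGalois K E := inferInstance
  let _ : Algebra (ZMod l) E := ((algebraMap L E).comp (algebraMap (ZMod l) L)).toAlgebra
  let ε : AlgebraicClosure (ZMod l) →ₐ[ZMod l] E := IsSepClosed.lift
  obtain ⟨F, _, q, hqo, hF⟩ := exists_field_commuting_lift (K := K) (L := L) hζ (ε : _ →+* E) hb hz
  refine ⟨F, inferInstance, (e.symm.toMonoidHom.prodMap (MonoidHom.id Z)).comp q, ?_, ?_⟩
  · have : ((e.symm.toMonoidHom.prodMap (MonoidHom.id Z)).comp q).ker = q.ker := by
      ext g
      simp [MonoidHom.mem_ker, Prod.ext_iff]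
    rwa [this]
  intro C _ _ Φ hΦ hp
  obtain ⟨Ψ, t, hΨ, ⟨g, hg, hqg⟩, hΨΦ, hΨt⟩ := hF Φ hΦ hp
  refine ⟨t, ⟨g, hg, by simp [hqg]⟩, fun υ hυ => ?_⟩
  obtain ⟨Ω, _, φ, υ', σ', hΩ, hυφ, hσφ, hσυ, κ, hκ⟩ := exists_tame_realization hζ (π := a υ)
    (by rw [← map_pow, hυ, map_one])
  let _ : Algebra L Ω := φ.toAlgebra
  let _ : Algebra K Ω := (φ.comp (algebraMap K L)).toAlgebra
  have : IsScalarTower K L Ω := IsScalarTower.of_algebraMap_eq fun _ => rfl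
  have hLl : CharP L l := charP_of_injective_algebraMap (algebraMap (ZMod l) L).injective l
  have hKl : CharP K l := (RingHom.charP_iff (algebraMap K L) (algebraMap K L).injective l).2 hLl
  have hζK : IsPrimitiveRoot (ZMod.castHom (dvd_refl l) K ζ) p :=
    hζ.map_of_injective (RingHom.injective _)
  have hpK : (p : K) ≠ 0 := by
    have := (ZMod.castHom (dvd_refl l) K).injective.ne hpl
    simpa using this
  have hΨp : IsPGroup p Ψ.range := by
    refine hp.of_injective (Subgroup.inclusion ?_) (Subgroup.inclusion_injective _)
    rintro _ ⟨α, rfl⟩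
    obtain ⟨g, hg, -⟩ := hΨΦ α
    exact ⟨g, hg.symm⟩
  obtain ⟨f, -, -, hf⟩ := exists_monoidHom_of_isSepClosed (L := L) (l := l) hζK hpK hΩ
    AlgebraicClosure.exists_pow_card_pow_eq Ψ hΨ hΨp
  have hυL : ∀ x, υ' (φ x) = φ (e υ x) := by
    have : (υ' : Ω →+* Ω).comp φ = φ.comp (ψ υ : L →+* L) :=
      FractionRing.ringHom_ext_mvPolynomial fun i => by
        rw [RingHom.comp_apply, RingHom.comp_apply]
        simp only [RingHom.coe_coe, hψX, hυφ]
    exact fun x => (RingHom.congr_fun this x).trans (congrArg φ (he υ x).symm)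
  have hσL : ∀ x, σ' (φ x) = φ (e 1 x) := fun x => by rw [hσφ, map_one]; rfl
  let υΩ : Gal(Ω/K) := AlgEquiv.ofRingEquiv (f := υ') fun x =>
    (hυL _).trans (congrArg φ ((e υ).commutes x))
  let σΩ : Gal(Ω/K) := AlgEquiv.ofRingEquiv (f := σ') fun x => hσφ _
  have key : ∀ (α : Gal(Ω/K)) (w : U) (n : ℕ), (∀ x, α (φ x) = φ (e w x)) →
      (∀ c, α (κ c) = κ c ^ n) →
      (∃ g, f α = Φ g ∧ ((e.symm.toMonoidHom.prodMap (MonoidHom.id Z)).comp q) g = (w, 1)) ∧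
        f α * t = t ^ n * f α := by
    intro α w n hα hn
    obtain ⟨β, hβ, hβL, hβε⟩ := hf α
    obtain ⟨g, hg, hqg⟩ := hΨΦ β
    refine ⟨⟨g, hβ.trans hg, ?_⟩, ?_⟩
    · have := hqg (e w) fun x => hβL x _ (hα x)
      simp [this]
    · rw [hβ]
      exact hΨt β n (hβε κ (ε : _ →+* E) n hn)
  obtain ⟨hu, hut⟩ := key υΩ υ 1 hυL fun c => by rw [pow_one]; exact (hκ c).1
  obtain ⟨hs, hst⟩ := key σΩ 1 l hσL fun c => (hκ c).2
  refine ⟨f υΩ, f σΩ, hu, hs, ?_, hst, ?_⟩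
  · rw [hut, pow_one]
  · rw [← map_mul, ← map_pow, ← map_mul]
    refine congrArg f (AlgEquiv.ext fun x => ?_)
    have hpow : ∀ (n : ℕ) (x : Ω), (υΩ ^ n) x = (υ' ^ n) x := by
      intro n
      induction n with
      | zero => intro x; rfl
      | succ n ih => intro x; rw [pow_succ, pow_succ]; exact ih _
    exact (RingEquiv.congr_fun hσυ x).trans (hpow l _).symm

end Realization

section UpperUnitriangular

open Matrix

variable {R : Type*} [CommRing R]

/-- The upper unitriangular `3 × 3` matrix with entries `a`, `b`, `c` above the diagonal. -/
def Matrix.unitriangular (a b c : R) : GL (Fin 3) R where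
  val := !![1, a, b; 0, 1, c; 0, 0, 1]
  inv := !![1, -a, a * c - b; 0, 1, -c; 0, 0, 1]
  val_inv := by
    ext i j
    fin_cases i <;> fin_cases j <;> simp [Matrix.mul_apply, Fin.sum_univ_three]
    ring
  inv_val := by
    ext i j
    fin_cases i <;> fin_cases j <;> simp [Matrix.mul_apply, Fin.sum_univ_three]
    ring

theorem Matrix.coe_unitriangular (a b c : R) :
    (unitriangular a b c : Matrix (Fin 3) (Fin 3) R) = !![1, a, b; 0, 1, c; 0, 0, 1] := rfl

theorem Matrix.unitriangular_mul (a b c x y z : R) :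
    unitriangular a b c * unitriangular x y z =
      unitriangular (a + x) (b + y + a * z) (c + z) := by
  apply Units.ext
  rw [Units.val_mul]
  simp only [coe_unitriangular]
  ext i j
  fin_cases i <;> fin_cases j <;> simp [Matrix.mul_apply, Fin.sum_univ_three] <;> ring

theorem Matrix.unitriangular_zero : unitriangular (0 : R) 0 0 = 1 := by
  apply Units.ext
  rw [coe_unitriangular, Units.val_one]
  ext i j
  fin_cases i <;> fin_cases j <;> simp

variable (R) in
/-- The subgroup of upper unitriangular `3 × 3` matrices. -/
def Matrix.unitriangularSubgroup : Subgroup (GL (Fin 3) R) where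
  carrier := {g | ∃ a b c, g = unitriangular a b c}
  mul_mem' := by
    rintro _ _ ⟨a, b, c, rfl⟩ ⟨x, y, z, rfl⟩
    exact ⟨_, _, _, unitriangular_mul ..⟩
  one_mem' := ⟨0, 0, 0, unitriangular_zero.symm⟩
  inv_mem' := by
    rintro _ ⟨a, b, c, rfl⟩
    refine ⟨-a, a * c - b, -c, ?_⟩
    rw [inv_eq_iff_mul_eq_one, unitriangular_mul, ← unitriangular_zero]
    congr 1 <;> ring

theorem Matrix.commute_unitriangular_zero_zero (b : R) (g : unitriangularSubgroup R) :
    Commute (g : GL (Fin 3) R) (unitriangular 0 b 0) := by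
  obtain ⟨_, x, y, z, rfl⟩ := g
  rw [Commute, SemiconjBy, unitriangular_mul, unitriangular_mul]
  congr 1 <;> ring

theorem Matrix.unitriangular_sub_one_cube (a b c : R) :
    ((unitriangular a b c : Matrix (Fin 3) (Fin 3) R) - 1) *
      ((unitriangular a b c : Matrix (Fin 3) (Fin 3) R) - 1) *
      ((unitriangular a b c : Matrix (Fin 3) (Fin 3) R) - 1) = 0 := by
  have h : (unitriangular a b c : Matrix (Fin 3) (Fin 3) R) - 1 =
      !![0, a, b; 0, 0, c; 0, 0, 0] := by
    rw [coe_unitriangular]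
    ext i j
    fin_cases i <;> fin_cases j <;> simp
  rw [h]
  ext i j
  fin_cases i <;> fin_cases j <;> simp [Matrix.mul_apply, Fin.sum_univ_three]

theorem Matrix.pow_prime_eq_one_of_mem_unitriangularSubgroup {p : ℕ} [Fact p.Prime] (hodd : p ≠ 2)
    {g : GL (Fin 3) (ZMod p)} (hg : g ∈ unitriangularSubgroup (ZMod p)) : g ^ p = 1 := by
  obtain ⟨a, b, c, rfl⟩ := hg
  have hp := (Fact.out : p.Prime)
  have h3 : p = 3 + (p - 3) := by have := hp.two_le; omega
  apply Units.ext
  have h : ((unitriangular a b c : Matrix (Fin 3) (Fin 3) (ZMod p)) - 1) ^ p = 0 := by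
    refine (congrArg _ h3).trans ?_
    rw [pow_add, pow_succ, sq, unitriangular_sub_one_cube, zero_mul]
  rw [sub_pow_char_of_commute _ (Commute.one_right _), one_pow, sub_eq_zero] at h
  simpa using h

/-- An element of `GL₃(ℤ/p²)` with unitriangular reduction modulo `p` has order dividing `p²`. -/
theorem Matrix.pow_prime_sq_eq_one_of_map_mem_unitriangularSubgroup {p : ℕ} (hp : p.Prime)
    (hodd : p ≠ 2) {g : GL (Fin 3) (ZMod (p ^ 2))}
    (hg : Matrix.GeneralLinearGroup.map (ZMod.castHom (dvd_pow_self p two_ne_zero) (ZMod p)) g ∈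
      unitriangularSubgroup (ZMod p)) : g ^ p ^ 2 = 1 := by
  obtain ⟨a, b, c, h⟩ := hg
  set π := ZMod.castHom (dvd_pow_self p two_ne_zero) (ZMod p)
  have hs : Function.Surjective π := ZMod.castHom_surjective _
  obtain ⟨a, rfl⟩ := hs a
  obtain ⟨b, rfl⟩ := hs b
  obtain ⟨c, rfl⟩ := hs c
  have hr : (g : Matrix (Fin 3) (Fin 3) (ZMod (p ^ 2))).map π =
      (unitriangular a b c : Matrix (Fin 3) (Fin 3) (ZMod (p ^ 2))).map π := by
    refine (congrArg Units.val h).trans ?_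
    simp only [coe_unitriangular]
    ext i j
    fin_cases i <;> fin_cases j <;> simp
  obtain ⟨Y, hY⟩ := Matrix.exists_eq_add_smul_of_map_castHom_eq hr
  have he : (p : ZMod (p ^ 2)) * p = 0 := by
    rw [← sq, ← Nat.cast_pow, ZMod.natCast_self]
  apply Units.ext
  have := one_add_nilpotent_pow_prime_sq hp hodd he (W := Y) (unitriangular_sub_one_cube a b c)
  rw [← add_assoc, add_sub_cancel, ← hY] at this
  simpa using this

end UpperUnitriangular

theorem ZMod.exists_prime_and_unit_orderOf_eq (p : ℕ) [hp : Fact p.Prime] :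
    ∃ l : ℕ, l.Prime ∧ l ≡ p + 1 [MOD p ^ 2] ∧ ∃ x : (ZMod l)ˣ, orderOf x = p := by
  have hcop : (p + 1).Coprime (p ^ 2) :=
    Nat.Coprime.pow_right 2 (by simp)
  obtain ⟨l, hl1, hl, hmod⟩ := Nat.forall_exists_prime_gt_and_modEq 1
    (pow_ne_zero 2 hp.out.ne_zero) hcop
  have : Fact l.Prime := ⟨hl⟩
  have h1 : l ≡ 1 [MOD p] := by
    have h := hmod.of_dvd (dvd_pow_self p two_ne_zero)
    simpa [Nat.ModEq] using h
  have hd : p ∣ Fintype.card (ZMod l)ˣ := by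
    rw [ZMod.card_units]
    exact (Nat.modEq_iff_dvd' hl.one_le).1 h1.symm
  exact ⟨l, hl, hmod, exists_prime_orderOf_dvd_card p hd⟩

theorem stmt_5 (p : ℕ) [Fact p.Prime] (hodd : p ≠ 2) :
    ∃ (F : Type) (_ : Field F),
      ∃ ρ : AbsGal F →* GL (Fin 3) (ZMod p),
        IsOpen (ρ.ker : Set (AbsGal F)) ∧
        ¬ ∃ ρ₂ : AbsGal F →* GL (Fin 3) (ZMod (p ^ 2)),
            IsOpen (ρ₂.ker : Set (AbsGal F)) ∧
            (Matrix.GeneralLinearGroup.map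
              (ZMod.castHom (dvd_pow_self p two_ne_zero) (ZMod p))).comp ρ₂ = ρ := by
  have hp : p.Prime := Fact.out
  have : NeZero (p ^ 2) := ⟨pow_ne_zero 2 hp.ne_zero⟩
  obtain ⟨l, hl, hmod, x, hx⟩ := ZMod.exists_prime_and_unit_orderOf_eq p
  have : Fact l.Prime := ⟨hl⟩
  have hζ : IsPrimitiveRoot (x : ZMod l) p :=
    IsPrimitiveRoot.coe_units_iff.2 (hx ▸ IsPrimitiveRoot.orderOf x)
  let z : Subgroup.zpowers x := ⟨x, Subgroup.mem_zpowers x⟩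
  let E : GL (Fin 3) (ZMod p) := Matrix.unitriangular 0 1 0
  have hE : E ∈ Matrix.unitriangularSubgroup (ZMod p) := ⟨_, _, _, rfl⟩
  have hEz : orderOf E ∣ orderOf z := by
    rw [← Subgroup.orderOf_coe z, show (z : (ZMod l)ˣ) = x from rfl, hx]
    exact orderOf_dvd_of_pow_eq_one (Matrix.pow_prime_eq_one_of_mem_unitriangularSubgroup hodd hE)
  have hz : ∀ y : Subgroup.zpowers x, y ∈ Subgroup.zpowers z := by
    rintro ⟨_, n, rfl⟩
    exact ⟨n, rfl⟩
  let c : Subgroup.zpowers x →* GL (Fin 3) (ZMod p) := monoidHomOfForallMemZpowers hz hEz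
  have hcz : c z = E := monoidHomOfForallMemZpowers_apply_gen hz hEz
  have hc : ∀ y, ∃ n : ℤ, c y = E ^ n := by
    intro y
    obtain ⟨n, rfl⟩ := hz y
    exact ⟨n, by simp [hcz]⟩
  let θ : Matrix.unitriangularSubgroup (ZMod p) × Subgroup.zpowers x →* GL (Fin 3) (ZMod p) :=
    (Matrix.unitriangularSubgroup (ZMod p)).subtype.noncommCoprod c fun g y => by
      obtain ⟨n, hn⟩ := hc y
      rw [hn]
      exact (Matrix.commute_unitriangular_zero_zero 1 g).zpow_right n
  have hθ : ∀ y, θ y ∈ Matrix.unitriangularSubgroup (ZMod p) := by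
    intro y
    obtain ⟨n, hn⟩ := hc y.2
    exact mul_mem y.1.2 (hn ▸ zpow_mem hE n)
  obtain ⟨F, _, q, hq, H⟩ := exists_field_lift_relations hζ
    (a := MulAction.toPermHom (Matrix.unitriangularSubgroup (ZMod p))
      (Matrix.unitriangularSubgroup (ZMod p)))
    MulAction.toPerm_injective
    (Subgroup.subtype_injective (Subgroup.zpowers x)) (z := z) rfl
  refine ⟨F, inferInstance, θ.comp q, Subgroup.isOpen_mono (fun g hg => by
    rw [MonoidHom.mem_ker] at hg ⊢
    rw [MonoidHom.comp_apply, hg, map_one]) hq, ?_⟩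
  rintro ⟨ρ₂, hρ₂, hcomp⟩
  have hred : ∀ g, Matrix.GeneralLinearGroup.map
      (ZMod.castHom (dvd_pow_self p two_ne_zero) (ZMod p)) (ρ₂ g) = θ (q g) :=
    fun g => DFunLike.congr_fun hcomp g
  have hP : IsPGroup p ρ₂.range := by
    rintro ⟨_, g, rfl⟩
    refine ⟨2, Subtype.ext
      (Matrix.pow_prime_sq_eq_one_of_map_mem_unitriangularSubgroup hp hodd ?_)⟩
    rw [hred]
    exact hθ _
  obtain ⟨_, ⟨g, rfl, hg⟩, ht⟩ := H ρ₂ hρ₂ hP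
  refine false_of_lift_commuting_pairs hp hodd hmod
    (t := (ρ₂ g : Matrix (Fin 3) (Fin 3) (ZMod (p ^ 2)))) ?_ fun e _ => ?_
  · have h := hred g
    rw [hg, show θ (1, z) = E by simp [θ, hcz]] at h
    exact congrArg Units.val h
  · obtain ⟨_, _, ⟨g₁, rfl, h₁⟩, ⟨g₂, rfl, h₂⟩, h₃, h₄, h₅⟩ :=
      ht ⟨Matrix.unitriangular 1 0 (e : ZMod p), _, _, _, rfl⟩ (Subtype.ext
        (Matrix.pow_prime_eq_one_of_mem_unitriangularSubgroup hodd ⟨_, _, _, rfl⟩))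
    refine ⟨ρ₂ g₁, ρ₂ g₂, ?_, ?_, congrArg Units.val h₃, congrArg Units.val h₄,
      congrArg Units.val h₅⟩
    · have h := hred g₁
      rw [h₁, show θ (⟨Matrix.unitriangular 1 0 (e : ZMod p), _, _, _, rfl⟩, 1) =
        Matrix.unitriangular 1 0 (e : ZMod p) by simp [θ]] at h
      exact congrArg Units.val h
    · have h := hred g₂
      rw [h₂, show ((1 : Matrix.unitriangularSubgroup (ZMod p)), (1 : Subgroup.zpowers x)) = 1
        from rfl, map_one] at h
      exact congrArg Units.val h
end

section
/- Let r ≥ 2 be an integer and let k = 𝔽_{2^r} be the finite field with 2^r elements. There exist a field F and a continuous homomorphism ρ : Gal(F_s/F) → GL_3(k) that admits no lift to a continuous homomorphism Gal(F_s/F) → GL_3(W_2(k)) along the reduction W_2(k) → k. -/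
open scoped MatrixGroups

/-- The canonical reduction `W₂(k) → k` on length-2 truncated Witt vectors. -/
noncomputable def wittRed (p : ℕ) [Fact p.Prime] (k : Type) [CommRing k] :
    TruncatedWittVector p 2 k →+* k :=
  RingHom.liftOfRightInverse (WittVector.truncate 2) TruncatedWittVector.out
    TruncatedWittVector.truncateFun_out
    ⟨WittVector.constantCoeff, by
      intro x hx
      rw [WittVector.mem_ker_truncate] at hx
      simpa [RingHom.mem_ker] using hx 0 (by norm_num)⟩

section WittReduction

variable {k : Type} [Field k]

theorem wittRed_truncate (x : WittVector 2 k) :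
    wittRed 2 k (WittVector.truncate 2 x) = x.coeff 0 :=
  RingHom.liftOfRightInverse_comp_apply (WittVector.truncate 2) TruncatedWittVector.out
    TruncatedWittVector.truncateFun_out ⟨WittVector.constantCoeff, _⟩ x

theorem wittRed_surjective : Function.Surjective (wittRed 2 k) := fun c =>
  ⟨WittVector.truncate 2 (WittVector.teichmuller 2 c), by
    rw [wittRed_truncate, WittVector.teichmuller_coeff_zero]⟩

theorem wittRed_eq_zero_iff_two_mul [CharP k 2] (y : TruncatedWittVector 2 2 k) :
    wittRed 2 k y = 0 ↔ 2 * y = 0 := by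
  obtain ⟨x, rfl⟩ := WittVector.truncate_surjective 2 2 k y
  have h : (2 : TruncatedWittVector 2 2 k) * WittVector.truncate 2 x
      = WittVector.truncate 2 (x * ((2 : ℕ) : WittVector 2 k)) := by
    rw [map_mul, mul_comm, map_natCast, Nat.cast_ofNat]
  rw [wittRed_truncate, h, ← RingHom.mem_ker, WittVector.mem_ker_truncate]
  constructor
  · intro hx i hi
    interval_cases i
    · exact WittVector.mul_charP_coeff_zero x
    · rw [WittVector.mul_charP_coeff_succ, hx]; simp
  · intro hx
    have := hx 1 (by norm_num)
    rw [WittVector.mul_charP_coeff_succ] at this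
    exact pow_eq_zero_iff (two_ne_zero) |>.1 this

theorem exists_two_mul_of_wittRed_eq_zero [CharP k 2] [PerfectRing k 2]
    (y : TruncatedWittVector 2 2 k) (hy : wittRed 2 k y = 0) : ∃ z, y = 2 * z := by
  obtain ⟨x, rfl⟩ := WittVector.truncate_surjective 2 2 k y
  rw [wittRed_truncate] at hy
  obtain ⟨c, hc⟩ := surjective_frobenius k 2 (x.coeff 1)
  rw [frobenius_def] at hc
  refine ⟨WittVector.truncate 2 (WittVector.teichmuller 2 c), ?_⟩
  have h : (2 : TruncatedWittVector 2 2 k) * WittVector.truncate 2 (WittVector.teichmuller 2 c)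
      = WittVector.truncate 2 (WittVector.teichmuller 2 c * ((2 : ℕ) : WittVector 2 k)) := by
    rw [map_mul, mul_comm, map_natCast, Nat.cast_ofNat]
  rw [h]
  ext i
  rw [WittVector.coeff_truncate, WittVector.coeff_truncate]
  fin_cases i
  · exact hy.trans (WittVector.mul_charP_coeff_zero _).symm
  · change x.coeff 1 = _
    rw [← hc]
    have := WittVector.mul_charP_coeff_succ (p := 2) (WittVector.teichmuller 2 c) 0
    rw [WittVector.teichmuller_coeff_zero] at this
    exact this.symm

end WittReduction

section FirstOrder

variable {A k : Type} [CommRing A] [Field k]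

/-- The elementary matrix with a single `1` in the upper right corner. -/
def corner (R : Type) [CommRing R] : Matrix (Fin 3) (Fin 3) R :=
  Matrix.of fun i j => if i = 0 ∧ j = 2 then 1 else 0

theorem exists_two_mul_map (red : A →+* k) (hsurj : Function.Surjective red)
    (h2 : ∀ y, red y = 0 ↔ 2 * y = 0) :
    ∃ ι : k →+ A, Function.Injective ι ∧ ∀ y, ι (red y) = 2 * y := by
  have key : ∀ y, 2 * Function.surjInv hsurj (red y) = 2 * y := by
    intro y
    have := (h2 (Function.surjInv hsurj (red y) - y)).1 (by
      rw [map_sub, Function.surjInv_eq hsurj, sub_self])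
    linear_combination this
  let ι : k →+ A := AddMonoidHom.mk' (fun c => 2 * Function.surjInv hsurj c) (by
    intro a b
    obtain ⟨a, rfl⟩ := hsurj a
    obtain ⟨b, rfl⟩ := hsurj b
    rw [← map_add red, key, key, key]; ring)
  refine ⟨ι, ?_, key⟩
  rw [injective_iff_map_eq_zero]
  intro a ha
  obtain ⟨a, rfl⟩ := hsurj a
  exact (h2 a).2 ((key a).symm.trans ha)

theorem square_coeffs (red : A →+* k) (h4 : (4 : A) = 0) (ι : k →+ A)
    (hinj : Function.Injective ι) (hι : ∀ y, ι (red y) = 2 * y) (w : A)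
    (m W : Matrix (Fin 3) (Fin 3) A) (hW : W = 1 + w • corner A + (2 : A) • m)
    (p : Matrix (Fin 3) (Fin 3) k) (hp : W * W = 1 + p.map ι) :
    p 0 2 = red w * (1 + red (m 0 0) + red (m 2 2)) ∧ p 0 0 = red w * red (m 2 0) := by
  have e1 := congrFun (congrFun hp 0) 2
  have e2 := congrFun (congrFun hp 0) 0
  simp [hW, Matrix.mul_apply, Fin.sum_univ_three, corner, Matrix.one_apply] at e1 e2
  constructor
  · apply hinj
    rw [← e1]
    have : red w * (1 + red (m 0 0) + red (m 2 2)) = red (w * (1 + m 0 0 + m 2 2)) := by simp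
    rw [this, hι]
    linear_combination (m 0 2 + m 0 0 * m 0 2 + m 0 1 * m 1 2 + m 0 2 * m 2 2) * h4
  · apply hinj
    have : red w * red (m 2 0) = red (w * m 2 0) := by simp
    rw [this, hι]
    linear_combination (m 0 0 + m 0 0 * m 0 0 + m 0 1 * m 1 0 + m 0 2 * m 2 0) * h4 - e2

theorem obstruction_eq_one [CharP k 2] (red : A →+* k) (hsurj : Function.Surjective red)
    (h4 : (4 : A) = 0) (hdiv : ∀ y, red y = 0 → ∃ z, y = 2 * z) (ι : k →+ A)
    (hinj : Function.Injective ι) (hι : ∀ y, ι (red y) = 2 * y)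
    (c : k) (hc0 : c ≠ 0) (hc1 : 1 + c ≠ 0)
    (X Y : Matrix (Fin 3) (Fin 3) A) (hX : X.map red = 1 + corner k)
    (hY : Y.map red = 1 + c • corner k) (pX pY pZ : Matrix (Fin 3) (Fin 3) k)
    (hpX : X * X = 1 + pX.map ι) (hpY : Y * Y = 1 + pY.map ι)
    (hpZ : (X * Y) * (X * Y) = 1 + pZ.map ι) :
    pX 0 2 + pY 0 2 / c + pZ 0 2 / (1 + c) + c * pX 0 0 + pY 0 0 / c = 1 := by
  have lift : ∀ (W : Matrix (Fin 3) (Fin 3) A) (w : A),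
      W.map red = 1 + (red w) • corner k → ∃ m, W = 1 + w • corner A + (2 : A) • m := by
    intro W w h
    have : ∀ i j, ∃ z, (W - (1 + w • corner A)) i j = 2 * z := by
      intro i j
      apply hdiv
      have := congrFun (congrFun h i) j
      rw [Matrix.map_apply] at this
      rw [Matrix.sub_apply, map_sub, this, sub_eq_zero]
      fin_cases i <;> fin_cases j <;> simp [corner]
    choose m hm using this
    refine ⟨Matrix.of m, ?_⟩
    ext i j
    have := hm i j
    simp only [Matrix.sub_apply] at this
    simp only [Matrix.add_apply, Matrix.smul_apply, Matrix.of_apply, smul_eq_mul] at this ⊢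
    linear_combination this
  obtain ⟨l, rfl⟩ := hsurj c
  obtain ⟨m, hm⟩ := lift X 1 (by simpa using hX)
  obtain ⟨n, hn⟩ := lift Y l hY
  have hZ : X * Y = 1 + (1 + l) • corner A +
      (2 : A) • (m + n + corner A * n + l • (m * corner A)) := by
    rw [hm, hn]
    ext i j
    fin_cases i <;> fin_cases j <;>
      simp [Matrix.mul_apply, Fin.sum_univ_three, corner, Matrix.one_apply]
    · linear_combination (m 0 0 * n 0 0 + m 0 1 * n 1 0 + m 0 2 * n 2 0) * h4
    · linear_combination (m 0 0 * n 0 1 + m 0 1 * n 1 1 + m 0 2 * n 2 1) * h4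
    · linear_combination (m 0 0 * n 0 2 + m 0 1 * n 1 2 + m 0 2 * n 2 2) * h4
    · linear_combination (m 1 0 * n 0 0 + m 1 1 * n 1 0 + m 1 2 * n 2 0) * h4
    · linear_combination (m 1 0 * n 0 1 + m 1 1 * n 1 1 + m 1 2 * n 2 1) * h4
    · linear_combination (m 1 0 * n 0 2 + m 1 1 * n 1 2 + m 1 2 * n 2 2) * h4
    · linear_combination (m 2 0 * n 0 0 + m 2 1 * n 1 0 + m 2 2 * n 2 0) * h4
    · linear_combination (m 2 0 * n 0 1 + m 2 1 * n 1 1 + m 2 2 * n 2 1) * h4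
    · linear_combination (m 2 0 * n 0 2 + m 2 1 * n 1 2 + m 2 2 * n 2 2) * h4
  obtain ⟨x1, x2⟩ := square_coeffs red h4 ι hinj hι 1 m X hm pX hpX
  obtain ⟨y1, y2⟩ := square_coeffs red h4 ι hinj hι l n Y hn pY hpY
  obtain ⟨z1, -⟩ := square_coeffs red h4 ι hinj hι (1 + l) _ _ hZ pZ hpZ
  rw [x1, x2, y1, y2, z1]
  have h2 : (2 : k) = 0 := CharTwo.two_eq_zero
  simp [Matrix.mul_apply, corner]
  rw [mul_div_cancel_left₀ _ hc0, mul_div_cancel_left₀ _ hc1, mul_div_cancel_left₀ _ hc0]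
  linear_combination (1 + red (m 0 0) + red (m 2 2) + red (n 0 0) + red (n 2 2) + red (n 2 0) +
    red l * red (m 2 0)) * h2

theorem exists_first_order_cocycle [CharP k 2] (red : A →+* k) (hsurj : Function.Surjective red)
    (h2 : ∀ y, red y = 0 ↔ 2 * y = 0) (hdiv : ∀ y, red y = 0 → ∃ z, y = 2 * z)
    {Γ : Type} [Group Γ] (ρ : Γ →* GL (Fin 3) k) (ρ₂ : Γ →* GL (Fin 3) A)
    (hρ : (Matrix.GeneralLinearGroup.map red).comp ρ₂ = ρ) :
    ∃ η : Γ → Matrix (Fin 3) (Fin 3) k,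
      (∀ n ∈ ρ.ker, ∀ m ∈ ρ.ker, η (n * m) = η n + η m) ∧
      (∀ γ, ∀ n ∈ ρ.ker, η (γ * n * γ⁻¹) = (ρ γ).1 * η n * (ρ γ)⁻¹.1) ∧
      (∀ n ∈ ρ₂.ker, η n = 0) ∧
      ∀ (c : k) (X Y : Γ), c ≠ 0 → 1 + c ≠ 0 → (ρ X).1 = 1 + corner k →
        (ρ Y).1 = 1 + c • corner k →
        η (X * X) 0 2 + η (Y * Y) 0 2 / c + η ((X * Y) * (X * Y)) 0 2 / (1 + c) +
          c * η (X * X) 0 0 + η (Y * Y) 0 0 / c = 1 := by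
  have h4 : (4 : A) = 0 := by
    have : red 2 = 0 := by rw [map_ofNat]; exact CharTwo.two_eq_zero
    have := (h2 2).1 this
    linear_combination this
  obtain ⟨ι, hinj, hι⟩ := exists_two_mul_map red hsurj h2
  have hred : ∀ γ, (ρ₂ γ).1.map red = (ρ γ).1 := by
    intro γ; rw [← hρ]; rfl
  have hex : ∀ W : Matrix (Fin 3) (Fin 3) A, W.map red = 1 → ∃ p : Matrix _ _ k,
      W = 1 + p.map ι := by
    intro W hW
    have : ∀ i j, ∃ z, (W - 1) i j = 2 * z := by
      intro i j
      apply hdiv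
      have := congrFun (congrFun hW i) j
      rw [Matrix.map_apply] at this
      rw [Matrix.sub_apply, map_sub, this, sub_eq_zero]
      by_cases hij : i = j <;> simp [Matrix.one_apply, hij]
    choose m hm using this
    refine ⟨Matrix.of fun i j => red (m i j), ?_⟩
    ext i j
    have := hm i j
    rw [Matrix.sub_apply] at this
    simp only [Matrix.add_apply, Matrix.map_apply, Matrix.of_apply, hι]
    linear_combination this
  have huniq : ∀ p q : Matrix (Fin 3) (Fin 3) k, (1 : Matrix _ _ A) + p.map ι = 1 + q.map ι →
      p = q := fun p q h => Matrix.map_injective hinj (add_left_cancel h)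
  have hker : ∀ n ∈ ρ.ker, (ρ₂ n).1.map red = 1 := by
    intro n hn
    rw [hred, MonoidHom.mem_ker.1 hn]; rfl
  have hηex : ∀ n, ∃ p : Matrix (Fin 3) (Fin 3) k, n ∈ ρ.ker → (ρ₂ n).1 = 1 + p.map ι := by
    intro n
    by_cases hn : n ∈ ρ.ker
    · obtain ⟨p, hp⟩ := hex _ (hker n hn)
      exact ⟨p, fun _ => hp⟩
    · exact ⟨0, fun h => absurd h hn⟩
  choose η hη using hηex
  have hιι : ∀ a b, ι a * ι b = 0 := by
    intro a b
    obtain ⟨a, rfl⟩ := hsurj a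
    obtain ⟨b, rfl⟩ := hsurj b
    rw [hι, hι]; linear_combination (a * b) * h4
  have hιl : ∀ (y : A) (c : k), y * ι c = ι (red y * c) := by
    intro y c
    obtain ⟨c, rfl⟩ := hsurj c
    rw [← map_mul, hι, hι]; ring
  have hιr : ∀ (y : A) (c : k), ι c * y = ι (c * red y) := by
    intro y c
    rw [mul_comm, hιl, mul_comm]
  refine ⟨η, ?_, ?_, ?_, ?_⟩
  · intro n hn m hm
    apply huniq
    rw [← hη _ (mul_mem hn hm), map_mul, Units.val_mul, hη n hn, hη m hm]
    have : (η n).map ι * (η m).map ι = 0 := by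
      ext i j
      simp [Matrix.mul_apply, hιι]
    rw [add_mul, mul_add, mul_add, this, Matrix.map_add _ (map_add ι)]
    simp
    abel
  · intro γ n hn
    apply huniq
    rw [← hη _ (Subgroup.Normal.conj_mem inferInstance n hn γ), map_mul, map_mul, Units.val_mul,
      Units.val_mul, hη n hn]
    have e : (ρ₂ γ).1 * (η n).map ι * (ρ₂ γ⁻¹).1 =
        ((ρ γ).1 * η n * (ρ γ)⁻¹.1).map ι := by
      have e1 : (ρ₂ γ).1 * (η n).map ι = ((ρ γ).1 * η n).map ι := by
        rw [← hred]
        ext i j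
        simp [Matrix.mul_apply, hιl]
      have e2 : ∀ q : Matrix (Fin 3) (Fin 3) k,
          q.map ι * (ρ₂ γ⁻¹).1 = (q * (ρ γ⁻¹).1).map ι := by
        intro q
        rw [← hred]
        ext i j
        simp only [Matrix.mul_apply, Matrix.map_apply, map_sum, hιr]
      rw [e1, e2, map_inv]
    rw [mul_add, add_mul, e, mul_one, ← Units.val_mul, ← map_mul, mul_inv_cancel, map_one]
    rfl
  · intro n hn
    have hn' : n ∈ ρ.ker := by
      rw [MonoidHom.mem_ker, ← hρ, MonoidHom.comp_apply, MonoidHom.mem_ker.1 hn, map_one]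
    apply huniq
    rw [← hη n hn', MonoidHom.mem_ker.1 hn]
    simp
  · intro c X Y hc0 hc1 hX hY
    have hsq : ∀ (d : k) (W : Γ), (ρ W).1 = 1 + d • corner k → W * W ∈ ρ.ker := by
      intro d W hW
      rw [MonoidHom.mem_ker, map_mul]
      apply Units.ext
      rw [Units.val_mul, hW, Units.val_one]
      have h2 : (2 : k) = 0 := CharTwo.two_eq_zero
      ext i j
      fin_cases i <;> fin_cases j <;>
        simp [Matrix.mul_apply, Fin.sum_univ_three, corner, Matrix.one_apply]
      linear_combination d * h2
    have hZ : (ρ (X * Y)).1 = 1 + (1 + c) • corner k := by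
      rw [map_mul, Units.val_mul, hX, hY]
      ext i j
      fin_cases i <;> fin_cases j <;>
        simp [Matrix.mul_apply, Fin.sum_univ_three, corner, Matrix.one_apply]
      ring
    refine obstruction_eq_one red hsurj h4 hdiv ι hinj hι c hc0 hc1 (ρ₂ X).1 (ρ₂ Y).1
      (by rw [hred, hX]) (by rw [hred, hY]) _ _ _ ?_ ?_ ?_
    · rw [← hη _ (hsq 1 X (by simpa using hX)), map_mul, Units.val_mul]
    · rw [← hη _ (hsq c Y hY), map_mul, Units.val_mul]
    · rw [← hη _ (hsq _ _ hZ), map_mul, map_mul, Units.val_mul, Units.val_mul]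

end FirstOrder

section OrbitSums

variable {W P k : Type} [AddCommGroup W] [Fintype W] [Field k]

open Classical in
theorem sum_eq_sum_fixed [CharP k 2] (hW : ∀ w : W, w + w = 0) (act : W → P → P)
    (h0 : ∀ q, act 0 q = q) (hadd : ∀ v w q, act (v + w) q = act v (act w q))
    (T : Finset P) (hT : ∀ w, ∀ q ∈ T, act w q ∈ T) (f : P → k)
    (hf : ∀ q ∈ T, ((∀ w, act w q = q → w = 0) ∧ ∑ w, f (act w q) = 0) ∨
      ∀ w, f (act w q) = f q) :
    ∑ q ∈ T, f q = ∑ q ∈ T with ∀ w, act w q = q, f q := by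
  rw [← Finset.sum_filter_add_sum_filter_not T (fun q => ∀ w, act w q = q)]
  convert add_zero _
  set N := T.filter fun q => ¬ ∀ w, act w q = q with hN
  let orb : P → Finset P := fun q => Finset.univ.image fun w => act w q
  have hmem : ∀ q, q ∈ orb q := fun q => Finset.mem_image.2 ⟨0, Finset.mem_univ _, h0 q⟩
  have horb : ∀ q w, orb (act w q) = orb q := by
    intro q w
    ext p
    simp only [orb, Finset.mem_image, Finset.mem_univ, true_and]
    constructor
    · rintro ⟨v, rfl⟩; exact ⟨v + w, hadd _ _ _⟩
    · rintro ⟨v, rfl⟩; exact ⟨v - w, by rw [← hadd, sub_add_cancel]⟩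
  have hNs : ∀ w, ∀ q ∈ N, act w q ∈ N := by
    intro w q hq
    rw [hN, Finset.mem_filter] at hq ⊢
    refine ⟨hT w q hq.1, fun h => hq.2 fun v => ?_⟩
    have := h v
    rw [← hadd, add_comm, hadd] at this
    calc act v q = act (w + w) (act v q) := by rw [hW, h0]
      _ = act w (act w (act v q)) := hadd _ _ _
      _ = act w (act w q) := by rw [this]
      _ = q := by rw [← hadd, hW, h0]
  have hfib : ∀ q ∈ N, N.filter (fun p => orb p = orb q) = orb q := by
    intro q hq
    ext p
    constructor
    · intro hp
      rw [← (Finset.mem_filter.1 hp).2]; exact hmem p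
    · intro hp
      obtain ⟨w, -, rfl⟩ := Finset.mem_image.1 hp
      exact Finset.mem_filter.2 ⟨hNs w q hq, horb q w⟩
  rw [← Finset.sum_fiberwise_of_maps_to (t := N.image orb) (g := orb)
    (fun q hq => Finset.mem_image_of_mem _ hq)]
  refine Finset.sum_eq_zero fun o ho => ?_
  obtain ⟨q, hq, rfl⟩ := Finset.mem_image.1 ho
  rw [hfib q hq]
  have hq' := Finset.mem_filter.1 hq
  rcases hf q hq'.1 with ⟨hfree, hsum⟩ | hconst
  · rw [Finset.sum_image, hsum]
    intro v _ w _ hvw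
    have : act (v - w) q = q := by
      have := congrArg (act (-w)) hvw
      simp only [← hadd, neg_add_cancel, h0] at this
      rw [sub_eq_neg_add]; exact this
    exact sub_eq_zero.1 (hfree _ this)
  · obtain ⟨w, hw⟩ := not_forall.1 hq'.2
    refine Finset.sum_involution (fun p _ => act w p) ?_ ?_ ?_ ?_
    · intro p hp
      obtain ⟨v, -, rfl⟩ := Finset.mem_image.1 hp
      rw [← hadd, hconst, hconst, CharTwo.add_self_eq_zero]
    · intro p hp _ h
      obtain ⟨v, -, rfl⟩ := Finset.mem_image.1 hp
      apply hw
      rw [← hadd, add_comm, hadd] at h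
      have := congrArg (act (-v)) h
      simpa only [← hadd, neg_add_cancel, h0, ← add_assoc, zero_add] using this
    · intro p hp
      obtain ⟨v, -, rfl⟩ := Finset.mem_image.1 hp
      exact Finset.mem_image.2 ⟨w + v, Finset.mem_univ _, hadd _ _ _⟩
    · intro p _
      rw [← hadd, hW, h0]

theorem FiniteField.sum_self_eq_zero [Fintype k] {c : k} (h0 : c ≠ 0) (h1 : c ≠ 1) :
    ∑ t : k, t = 0 := by
  have h : ∑ t : k, t = c * ∑ t : k, t := by
    rw [Finset.mul_sum]
    exact (Equiv.sum_comp (Equiv.mulLeft₀ c h0) (fun t => t)).symm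
  have : (1 - c) * ∑ t : k, t = 0 := by linear_combination h
  rcases mul_eq_zero.1 this with h | h
  · exact absurd (sub_eq_zero.1 h).symm h1
  · exact h

open Classical in
theorem sum_eq_sum_fixed_of_affine [CharP k 2] [Fintype k] {c : k} (hc0 : c ≠ 0) (hc1 : c ≠ 1)
    (act : k → P → P) (h0 : ∀ q, act 0 q = q)
    (hadd : ∀ v w q, act (v + w) q = act v (act w q)) (T : Finset P)
    (hT : ∀ w, ∀ q ∈ T, act w q ∈ T) (f s : P → k)
    (hf : ∀ q ∈ T, ∀ t, f (act t q) = f q + t * s q) :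
    ∑ q ∈ T, f q = ∑ q ∈ T with ∀ w, act w q = q, f q := by
  refine sum_eq_sum_fixed CharTwo.add_self_eq_zero act h0 hadd T hT f fun q hq => ?_
  by_cases h : ∀ w, act w q = q → w = 0
  · refine Or.inl ⟨h, ?_⟩
    simp only [hf q hq]
    rw [Finset.sum_add_distrib, ← Finset.sum_mul, FiniteField.sum_self_eq_zero hc0 hc1]
    simp
  · push Not at h
    obtain ⟨w, hw, hw0⟩ := h
    have := hf q hq w
    rw [hw, left_eq_add] at this
    have hs := (mul_eq_zero.1 this).resolve_left hw0
    exact Or.inr fun t => by rw [hf q hq, hs, mul_zero, add_zero]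

end OrbitSums

section Transvections

variable {k : Type} [Field k]

/-- The elementary matrix `1 + t E_{ij}`, as an element of the general linear group. -/
def elementary (i j : Fin 3) (h : i ≠ j) (t : k) : GL (Fin 3) k where
  val := Matrix.transvection i j t
  inv := Matrix.transvection i j (-t)
  val_inv := by rw [Matrix.transvection_mul_transvection_same _ _ h, add_neg_cancel,
    Matrix.transvection_zero]
  inv_val := by rw [Matrix.transvection_mul_transvection_same _ _ h, neg_add_cancel,
    Matrix.transvection_zero]

theorem elementary_add (i j : Fin 3) (h : i ≠ j) (s t : k) :
    elementary i j h (s + t) = elementary i j h s * elementary i j h t :=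
  Units.ext (Matrix.transvection_mul_transvection_same _ _ h _ _).symm

theorem elementary_zero (i j : Fin 3) (h : i ≠ j) : elementary i j h (0 : k) = 1 :=
  Units.ext (Matrix.transvection_zero _ _)

theorem elementary_inv (i j : Fin 3) (h : i ≠ j) (t : k) :
    (elementary i j h t)⁻¹ = elementary i j h (-t) := by
  rw [inv_eq_iff_mul_eq_one, ← elementary_add, add_neg_cancel, elementary_zero]

abbrev elA (t : k) : GL (Fin 3) k := elementary 0 1 (by decide) t
abbrev elB (t : k) : GL (Fin 3) k := elementary 1 2 (by decide) t
abbrev elC (t : k) : GL (Fin 3) k := elementary 0 2 (by decide) t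

theorem elA_mul_elB (s t : k) : elA s * elB t = elC (s * t) * elB t * elA s := by
  apply Units.ext
  simp only [Units.val_mul, elementary, Matrix.transvection]
  ext i j
  fin_cases i <;> fin_cases j <;>
    simp [Matrix.mul_apply, Fin.sum_univ_three, Matrix.single_apply]

theorem elA_mul_elC (s t : k) : elA s * elC t = elC t * elA s := by
  apply Units.ext
  simp only [Units.val_mul, elementary, Matrix.transvection]
  ext i j
  fin_cases i <;> fin_cases j <;>
    simp [Matrix.mul_apply, Fin.sum_univ_three, Matrix.single_apply]

theorem elB_mul_elC (s t : k) : elB s * elC t = elC t * elB s := by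
  apply Units.ext
  simp only [Units.val_mul, elementary, Matrix.transvection]
  ext i j
  fin_cases i <;> fin_cases j <;>
    simp [Matrix.mul_apply, Fin.sum_univ_three, Matrix.single_apply]

theorem elC_mul_elC (s t : k) : elC s * elC t = elC t * elC s := by
  rw [← elementary_add, ← elementary_add, add_comm]

theorem elC_conj [CharP k 2] (t : k) (m : Matrix (Fin 3) (Fin 3) k) :
    ((elC t).1 * m * (elC t)⁻¹.1) 0 2 = m 0 2 + t * (m 0 0 + m 2 2) + t ^ 2 * m 2 0 ∧
    ((elC t).1 * m * (elC t)⁻¹.1) 0 0 = m 0 0 + t * m 2 0 ∧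
    ((elC t).1 * m * (elC t)⁻¹.1) 0 1 = m 0 1 + t * m 2 1 ∧
    ((elC t).1 * m * (elC t)⁻¹.1) 1 2 = m 1 2 + t * m 1 0 := by
  have h2 : (2 : k) = 0 := CharTwo.two_eq_zero
  rw [elementary_inv]
  simp only [elementary, Matrix.transvection]
  refine ⟨?_, ?_, ?_, ?_⟩ <;>
    simp [Matrix.mul_apply, Fin.sum_univ_three, Matrix.single_apply, CharTwo.neg_eq] <;>
    ring

theorem elA_conj [CharP k 2] (t : k) (m : Matrix (Fin 3) (Fin 3) k) :
    ((elA t).1 * m * (elA t)⁻¹.1) 0 2 = m 0 2 + t * m 1 2 ∧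
    ((elA t).1 * m * (elA t)⁻¹.1) 0 0 = m 0 0 + t * m 1 0 := by
  rw [elementary_inv]
  simp only [elementary, Matrix.transvection]
  refine ⟨?_, ?_⟩ <;>
    simp [Matrix.mul_apply, Fin.sum_univ_three, Matrix.single_apply, CharTwo.neg_eq]

theorem elB_conj [CharP k 2] (t : k) (m : Matrix (Fin 3) (Fin 3) k) :
    ((elB t).1 * m * (elB t)⁻¹.1) 0 2 = m 0 2 + t * m 0 1 ∧
    ((elB t).1 * m * (elB t)⁻¹.1) 0 0 = m 0 0 := by
  rw [elementary_inv]
  simp only [elementary, Matrix.transvection]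
  refine ⟨?_, ?_⟩ <;>
    simp [Matrix.mul_apply, Fin.sum_univ_three, Matrix.single_apply, CharTwo.neg_eq]
  ring

theorem relations_of_elC_conj_eq [CharP k 2] {t : k} (ht : t ≠ 0)
    {m : Matrix (Fin 3) (Fin 3) k} (h : (elC t).1 * m * (elC t)⁻¹.1 = m) :
    m 2 0 = 0 ∧ m 0 0 + m 2 2 = 0 ∧ m 2 1 = 0 ∧ m 1 0 = 0 := by
  obtain ⟨h1, h2, h3, h4⟩ := elC_conj t m
  rw [h, left_eq_add, mul_eq_zero, or_iff_right ht] at h2 h3 h4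
  rw [h, h2, mul_zero, add_zero, left_eq_add, mul_eq_zero, or_iff_right ht] at h1
  exact ⟨h2, h1, h3, h4⟩

end Transvections

section SignCocycle

variable {G Γ P K : Type} [Group G] [Group Γ] [MulAction G P] [Field K]

/-- A cocycle of the group `Γ`, acting on `P` through `ρ`, with values in the nonzero functions
from `P` to `K`, that takes the values `±1` on the kernel of `ρ`. -/
structure IsSignCocycle (ρ : Γ →* G) (u : Γ → P → K) : Prop where
  map_mul : ∀ γ δ q, u (γ * δ) q = u γ (ρ δ • q) * u δ q
  sq_eq_one : ∀ n ∈ ρ.ker, ∀ q, u n q * u n q = 1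

namespace IsSignCocycle

variable {ρ : Γ →* G} {u : Γ → P → K}

theorem map_one (h : IsSignCocycle ρ u) (q : P) : u 1 q = 1 := by
  have h1 := h.map_mul 1 1 q
  have h2 := h.sq_eq_one 1 (one_mem _) q
  rw [_root_.map_one, one_smul, mul_one] at h1
  rw [h1, h2]

theorem ne_zero (h : IsSignCocycle ρ u) (γ : Γ) (q : P) : u γ q ≠ 0 := by
  intro h0
  have := h.map_mul γ⁻¹ γ q
  rw [inv_mul_cancel, h.map_one, h0, mul_zero] at this
  exact one_ne_zero this

theorem conj (h : IsSignCocycle ρ u) (γ : Γ) {n : Γ} (hn : n ∈ ρ.ker) (q : P) :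
    u (γ * n * γ⁻¹) (ρ γ • q) = u n q := by
  have h1 := h.map_mul (γ * n * γ⁻¹) γ q
  have h2 := h.map_mul γ n q
  rw [inv_mul_cancel_right, h2, MonoidHom.mem_ker.1 hn, one_smul, mul_comm] at h1
  exact (mul_right_cancel₀ (h.ne_zero γ q) h1).symm

theorem sq (h : IsSignCocycle ρ u) (w : Γ) (q : P) : u (w * w) q = u w (ρ w • q) * u w q :=
  h.map_mul w w q

theorem sq_smul_self (h : IsSignCocycle ρ u) {w : Γ} (hw : w * w ∈ ρ.ker) (q : P) :
    u (w * w) (ρ w • q) = u (w * w) q := by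
  have := h.conj w hw q
  rwa [show w * (w * w) * w⁻¹ = w * w by group] at this

theorem sq_smul_of_commute (h : IsSignCocycle ρ u) {w γ : Γ} (hw : w * w ∈ ρ.ker)
    (hc : ρ γ * ρ w = ρ w * ρ γ) {q : P} (hq : ρ w • q = q) :
    u (w * w) (ρ γ • q) = u (w * w) q := by
  rw [← h.conj γ hw q]
  set n := w⁻¹ * (γ * w * γ⁻¹) with hn
  have hnk : n ∈ ρ.ker := by
    rw [MonoidHom.mem_ker, hn]
    simp only [_root_.map_mul, map_inv]
    rw [hc]; group
  have e : γ * (w * w) * γ⁻¹ = (w * n) * (w * n) := by rw [hn]; group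
  have hq' : ρ w • ρ γ • q = ρ γ • q := by rw [← mul_smul, ← hc, mul_smul, hq]
  have hwn : u (w * n) (ρ γ • q) = u w (ρ γ • q) * u n (ρ γ • q) := by
    rw [h.map_mul, MonoidHom.mem_ker.1 hnk, one_smul]
  have hρ : ρ (w * n) • ρ γ • q = ρ γ • q := by
    rw [_root_.map_mul, MonoidHom.mem_ker.1 hnk, mul_one, hq']
  rw [e, h.sq (w * n), hρ, hwn, h.sq, hq', mul_mul_mul_comm, h.sq_eq_one n hnk, mul_one]

theorem sq_eq_one_of_commutator (h : IsSignCocycle ρ u) {w α β : Γ}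
    (hc : ρ α * ρ β = ρ w * ρ β * ρ α) {q : P} (hα : ρ α • q = q) (hβ : ρ β • q = q)
    (hw : ρ w • q = q) : u (w * w) q = 1 := by
  set n := (α * β)⁻¹ * (w * β * α) with hn
  have hnk : n ∈ ρ.ker := by
    rw [MonoidHom.mem_ker, hn]
    simp only [_root_.map_mul, map_inv]
    rw [hc]; group
  have e : w * β * α = α * β * n := by rw [hn]; group
  have h1 := congrArg (fun γ => u γ q) e
  simp only [h.map_mul, hα, hβ, MonoidHom.mem_ker.1 hnk, one_smul] at h1
  have h2 : u w q = u n q := by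
    apply mul_right_cancel₀ (mul_ne_zero (h.ne_zero β q) (h.ne_zero α q))
    linear_combination h1
  rw [h.sq, hw, h2, h.sq_eq_one n hnk]

theorem prod_six (h : IsSignCocycle ρ u) {x y : Γ} (hx : ρ x * ρ x = 1) (hy : ρ y * ρ y = 1)
    (hxy : ρ x * ρ y = ρ y * ρ x) (q : P) :
    u (x * x) q * u (x * x) (ρ y • q) * (u (y * y) q * u (y * y) (ρ x • q)) *
      (u ((x * y) * (x * y)) q * u ((x * y) * (x * y)) (ρ x • q)) = 1 := by
  have hx' : ∀ p : P, ρ x • ρ x • p = p := fun p => by rw [← mul_smul, hx, one_smul]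
  have hy' : ∀ p : P, ρ y • ρ y • p = p := fun p => by rw [← mul_smul, hy, one_smul]
  have hc : ∀ p : P, ρ y • ρ x • p = ρ x • ρ y • p := fun p => by
    rw [← mul_smul, ← mul_smul, hxy]
  have hz : (x * y) * (x * y) ∈ ρ.ker := by
    rw [MonoidHom.mem_ker]
    simp only [_root_.map_mul]
    rw [mul_assoc, ← mul_assoc (ρ y), ← hxy, mul_assoc, hy, mul_one, hx]
  have hz1 := h.sq_eq_one _ hz q
  have hz2 := h.sq_eq_one _ hz (ρ x • q)
  rw [h.sq] at hz1 hz2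
  simp only [h.map_mul, _root_.map_mul, mul_smul, hx', hy', hc] at hz1 hz2 ⊢
  linear_combination (u x q * u y (ρ y • q) * (u x (ρ x • ρ y • q) * u y (ρ x • q))) ^ 2 * hz1 +
    hz2

end IsSignCocycle

end SignCocycle

section Vanishing

variable {k K : Type} [Field k] [Field K]

open Classical in
/-- The exponent, in a field of characteristic two, of a sign. -/
noncomputable def signExp (k : Type) [Field k] (s : K) : k := if s = 1 then 0 else 1

theorem signExp_one : signExp k (1 : K) = 0 := if_pos rfl

theorem signExp_mul [CharP k 2] {s t : K} (hs : s * s = 1) (ht : t * t = 1) :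
    signExp k (s * t) = signExp k s + signExp k t := by
  unfold signExp
  rcases mul_self_eq_one_iff.1 hs with rfl | rfl <;>
    rcases mul_self_eq_one_iff.1 ht with rfl | rfl <;>
    by_cases h : (-1 : K) = 1 <;> simp [h, CharTwo.add_self_eq_zero]

theorem sum_four_eq_zero [CharP k 2] {c : k} (hc0 : c ≠ 0) (hc1 : 1 + c ≠ 0) (m : k) (p α γ : k)
    {e₁ e₂ f₁ f₂ g₁ g₂ : k} (six : e₁ + e₂ + (f₁ + f₂) + (g₁ + g₂) = 0) :
    e₁ * (m + c * p) + f₁ * ((m + p) / c) + g₁ * (m / (1 + c)) +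
      (e₂ * (m + c * α + c ^ 2 * γ + c * (p + c * γ)) +
        f₁ * ((m + c * α + c ^ 2 * γ + (p + c * γ)) / c) +
        g₂ * ((m + c * α + c ^ 2 * γ) / (1 + c))) +
      (e₁ * (m + 1 * α + 1 ^ 2 * γ + c * (p + 1 * γ)) +
        f₂ * ((m + 1 * α + 1 ^ 2 * γ + (p + 1 * γ)) / c) +
        g₂ * ((m + 1 * α + 1 ^ 2 * γ) / (1 + c)) +
      (e₂ * (m + (1 + c) * α + (1 + c) ^ 2 * γ + c * (p + (1 + c) * γ)) +
        f₂ * ((m + (1 + c) * α + (1 + c) ^ 2 * γ + (p + (1 + c) * γ)) / c) +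
        g₁ * ((m + (1 + c) * α + (1 + c) ^ 2 * γ) / (1 + c)))) = 0 := by
  have h2 : (2 : k) = 0 := CharTwo.two_eq_zero
  have hi := mul_inv_cancel₀ hc0
  have hj := mul_inv_cancel₀ hc1
  simp only [div_eq_mul_inv]
  generalize c⁻¹ = i at *
  generalize (1 + c)⁻¹ = j at *
  linear_combination (α + (1 + c) * γ) * six + e₁ * (m + c * p) * h2 +
    e₂ * (m + c * α + (c ^ 2 + c) * γ + c * p + c ^ 2 * γ) * h2 +
    f₁ * ((m + p) * i * h2 + (α + c * γ + γ) * hi) +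
    f₂ * ((m + p + α + 2 * γ + c * γ) * i * h2 + (α + (1 + c) * γ) * hi) +
    g₁ * (m * j * h2 + (α + (1 + c) * γ) * hj) +
    g₂ * ((m - c * γ) * j * h2 + (α + (1 + c) * γ) * hj)

variable {Γ P : Type} [Group Γ] [MulAction (GL (Fin 3) k) P]

/-- The contribution of the point `q` to the obstruction. -/
noncomputable def localTerm (c : k) (u : Γ → P → K) (X Y : Γ) (a : P → Matrix (Fin 3) (Fin 3) k)
    (q : P) : k :=
  signExp k (u (X * X) q) * (a q 0 2 + c * a q 0 0) +
    signExp k (u (Y * Y) q) * ((a q 0 2 + a q 0 0) / c) +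
    signExp k (u ((X * Y) * (X * Y)) q) * (a q 0 2 / (1 + c))

open Classical in
theorem sum_localTerm_eq_zero [CharP k 2] [Fintype k] {c : k} (hc0 : c ≠ 0) (hc1 : 1 + c ≠ 0)
    {ρ : Γ →* GL (Fin 3) k} (hρ : Function.Surjective ρ) {u : Γ → P → K}
    (hu : IsSignCocycle ρ u) (S : Finset P) (hS : ∀ g : GL (Fin 3) k, ∀ q ∈ S, g • q ∈ S)
    (a : P → Matrix (Fin 3) (Fin 3) k)
    (ha : ∀ (g : GL (Fin 3) k) (q : P), a (g • q) = g.1 * a q * g⁻¹.1)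
    {X Y : Γ} (hX : ρ X = elC 1) (hY : ρ Y = elC c) :
    ∑ q ∈ S, localTerm c u X Y a q = 0 := by
  have hc1' : c ≠ 1 := fun h => hc1 (by rw [h, CharTwo.add_self_eq_zero])
  have hZ : ρ (X * Y) = elC (1 + c) := by rw [map_mul, hX, hY, ← elementary_add]
  have hsq : ∀ (w : Γ) (t : k), ρ w = elC t → w * w ∈ ρ.ker := fun w t h => by
    rw [MonoidHom.mem_ker, map_mul, h, ← elementary_add, CharTwo.add_self_eq_zero,
      elementary_zero]
  have hXk := hsq X 1 hX
  have hYk := hsq Y c hY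
  have hZk := hsq _ _ hZ
  -- the part of `S` on which the two central elements act trivially
  have sum_eq_sum_T₁ : ∑ q ∈ S, localTerm c u X Y a q =
      ∑ q ∈ S with (elC (1 : k) • q = q ∧ elC c • q = q), localTerm c u X Y a q := by
    let e : ZMod 2 × ZMod 2 → k := fun w => (w.1.val : k) + (w.2.val : k) * c
    have he : ∀ v w, e (v + w) = e v + e w := by
      have h2 : (2 : k) = 0 := CharTwo.two_eq_zero
      have hval : ∀ i j : ZMod 2, (((i + j).val : ℕ) : k) = (i.val : k) + (j.val : k) := by
        intro i j
        rw [ZMod.val_add, ← Nat.cast_add]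
        conv_rhs => rw [← Nat.mod_add_div (i.val + j.val) 2]
        push_cast
        linear_combination -(((i.val + j.val) / 2 : ℕ) : k) * h2
      intro v w
      simp only [e, Prod.fst_add, Prod.snd_add, hval]
      ring
    have e00 : e (0, 0) = 0 := by simp [e]
    have e10 : e (1, 0) = 1 := by simp [e]
    have e01 : e (0, 1) = c := by simp [e]
    have e11 : e (1, 1) = 1 + c := by simp [e]
    have he0 : ∀ w, w ≠ 0 → e w ≠ 0 := by
      intro w hw
      have : w = (1, 0) ∨ w = (0, 1) ∨ w = (1, 1) := by revert w; decide
      rcases this with rfl | rfl | rfl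
      · rw [e10]; exact one_ne_zero
      · rw [e01]; exact hc0
      · rw [e11]; exact hc1
    have hfix : ∀ q : P, (∀ w, elC (e w) • q = q) ↔ (elC (1 : k) • q = q ∧ elC c • q = q) := by
      intro q
      constructor
      · intro h
        exact ⟨by simpa only [e10] using h (1, 0), by simpa only [e01] using h (0, 1)⟩
      · rintro ⟨h1, h2⟩ w
        have : w = (0, 0) ∨ w = (1, 0) ∨ w = (0, 1) ∨ w = (1, 1) := by revert w; decide
        rcases this with rfl | rfl | rfl | rfl
        · rw [e00, elC, elementary_zero, one_smul]
        · rw [e10, h1]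
        · rw [e01, h2]
        · rw [e11, elC, elementary_add, mul_smul, h2, h1]
    rw [sum_eq_sum_fixed (W := ZMod 2 × ZMod 2) (by decide) (fun w q => elC (e w) • q)
      (fun q => by
        change elC (e (0, 0)) • q = q
        rw [e00, elC, elementary_zero, one_smul])
      (fun v w q => by rw [he, elC, elementary_add, mul_smul]) S (fun w q hq => hS _ q hq)]
    · simp only [hfix]
    intro q hq
    by_cases hfree : ∀ w, elC (e w) • q = q → w = 0
    · refine Or.inl ⟨hfree, ?_⟩
      rw [Fintype.sum_prod_type]
      change ∑ i : Fin 2, ∑ j : Fin 2, localTerm c u X Y a (elC (e (i, j)) • q) = 0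
      rw [Fin.sum_univ_two, Fin.sum_univ_two, Fin.sum_univ_two]
      change localTerm c u X Y a (elC (e (0, 0)) • q) + localTerm c u X Y a (elC (e (0, 1)) • q) +
        (localTerm c u X Y a (elC (e (1, 0)) • q) + localTerm c u X Y a (elC (e (1, 1)) • q)) = 0
      rw [e00, e01, e10, e11, show elC (0 : k) = 1 from elementary_zero _ _ _, one_smul]
      have hadd : ∀ s t : k, elC (s + t) = elC s * elC t := elementary_add 0 2 (by decide)
      have pX := hu.sq_smul_self hXk
      have pY := hu.sq_smul_self hYk
      have pZ := hu.sq_smul_self hZk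
      rw [hX] at pX
      rw [hY] at pY
      rw [hZ] at pZ
      have hX3 : u (X * X) (elC (1 + c) • q) = u (X * X) (elC c • q) := by
        rw [hadd, mul_smul, pX]
      have hY3 : u (Y * Y) (elC (1 + c) • q) = u (Y * Y) (elC (1 : k) • q) := by
        rw [add_comm, hadd, mul_smul, pY]
      have hZ2 : u (X * Y * (X * Y)) (elC c • q) = u (X * Y * (X * Y)) (elC (1 : k) • q) := by
        have : elC c • q = elC (1 + c) • elC (1 : k) • q := by
          rw [← mul_smul, ← hadd]
          congr 2
          linear_combination -(CharTwo.two_eq_zero (R := k))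
        rw [this, pZ]
      have six := hu.prod_six (x := X) (y := Y)
        (by rw [← map_mul]; exact MonoidHom.mem_ker.1 hXk)
        (by rw [← map_mul]; exact MonoidHom.mem_ker.1 hYk)
        (by rw [hX, hY, elC_mul_elC]) q
      rw [hX, hY] at six
      have sX := hu.sq_eq_one _ hXk
      have sY := hu.sq_eq_one _ hYk
      have sZ := hu.sq_eq_one _ hZk
      have six' := congrArg (signExp k) six
      have hmul : ∀ s t : K, s * s = 1 → t * t = 1 → (s * t) * (s * t) = 1 := by
        intro s t hs ht
        rw [mul_mul_mul_comm, hs, ht, mul_one]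
      rw [signExp_one, signExp_mul (hmul _ _ (hmul _ _ (sX _) (sX _)) (hmul _ _ (sY _) (sY _)))
        (hmul _ _ (sZ _) (sZ _)), signExp_mul (hmul _ _ (sX _) (sX _)) (hmul _ _ (sY _) (sY _)),
        signExp_mul (sX _) (sX _), signExp_mul (sY _) (sY _), signExp_mul (sZ _) (sZ _)] at six'
      simp only [localTerm, pX, pY, pZ, hX3, hY3, hZ2, ha, (elC_conj _ _).1, (elC_conj _ _).2.1]
      exact sum_four_eq_zero hc0 hc1 _ _ _ _ six'
    · right
      push Not at hfree
      obtain ⟨d, hd, hd0⟩ := hfree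
      have hm := ha (elC (e d)) q
      rw [hd] at hm
      obtain ⟨r1, r2, r3, r4⟩ := relations_of_elC_conj_eq (he0 d hd0) hm.symm
      have hε : ∀ (w : Γ) (w' : ZMod 2 × ZMod 2), ρ w = elC (e w') → w' ≠ 0 →
          ∀ v, u (w * w) (elC (e v) • q) = u (w * w) q := by
        intro w w' hw hw0 v
        have hwk := hsq w _ hw
        by_cases hwq : ρ w • q = q
        · obtain ⟨γ, hγ⟩ := hρ (elC (e v))
          rw [← hγ]
          exact hu.sq_smul_of_commute hwk (by rw [hγ, hw, elC_mul_elC]) hwq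
        · have hne : w' ≠ d := by
            rintro rfl
            exact hwq (by rw [hw, hd])
          have hv : v = 0 ∨ v = d ∨ v = w' ∨ v = w' + d := by
            have : ∀ v w d : ZMod 2 × ZMod 2, d ≠ 0 → w ≠ 0 → w ≠ d →
                v = 0 ∨ v = d ∨ v = w ∨ v = w + d := by decide
            exact this v w' d hd0 hw0 hne
          rcases hv with rfl | rfl | rfl | rfl
          · change u (w * w) (elC (e (0, 0)) • q) = _
            rw [e00, elC, elementary_zero, one_smul]
          · rw [hd]
          · rw [← hw, hu.sq_smul_self hwk]
          · rw [he, elC, elementary_add, mul_smul, hd, ← elC, ← hw, hu.sq_smul_self hwk]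
      intro v
      simp only [localTerm]
      rw [hε X (1, 0) (by rw [hX, e10]) (by decide) v, hε Y (0, 1) (by rw [hY, e01]) (by decide) v,
        hε (X * Y) (1, 1) (by rw [hZ, e11]) (by decide) v, ha, (elC_conj _ _).1,
        (elC_conj _ _).2.1, r1, r2]
      simp only [mul_zero, add_zero]
  have hone : ∀ i j (h : i ≠ j) (q : P), elementary i j h (0 : k) • q = q := fun i j h q => by
    rw [elementary_zero, one_smul]
  have hadd : ∀ i j (h : i ≠ j) (s t : k) (q : P),
      elementary i j h (s + t) • q = elementary i j h s • elementary i j h t • q :=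
    fun i j h s t q => by rw [elementary_add, mul_smul]
  set T₁ := S.filter fun q => elC (1 : k) • q = q ∧ elC c • q = q with hT₁
  have hmat : ∀ q ∈ T₁, a q 2 0 = 0 ∧ a q 0 0 + a q 2 2 = 0 ∧ a q 2 1 = 0 ∧ a q 1 0 = 0 := by
    intro q hq
    refine relations_of_elC_conj_eq one_ne_zero ?_
    rw [← ha, (Finset.mem_filter.1 hq).2.1]
  have hsign : ∀ q ∈ T₁, ∀ g : GL (Fin 3) k, (∀ t : k, g * elC t = elC t * g) →
      u (X * X) (g • q) = u (X * X) q ∧ u (Y * Y) (g • q) = u (Y * Y) q ∧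
        u ((X * Y) * (X * Y)) (g • q) = u ((X * Y) * (X * Y)) q := by
    intro q hq g hg
    obtain ⟨h1, h2⟩ := (Finset.mem_filter.1 hq).2
    obtain ⟨γ, rfl⟩ := hρ g
    refine ⟨hu.sq_smul_of_commute hXk (by rw [hX, hg]) (by rw [hX, h1]),
      hu.sq_smul_of_commute hYk (by rw [hY, hg]) (by rw [hY, h2]),
      hu.sq_smul_of_commute hZk (by rw [hZ, hg]) (by rw [hZ, hadd, h2, h1])⟩
  set T₂ := T₁.filter fun q => ∀ t : k, elC t • q = q with hT₂
  set T₃ := T₂.filter fun q => ∀ t : k, elA t • q = q with hT₃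
  set T₄ := T₃.filter fun q => ∀ t : k, elB t • q = q with hT₄
  have mem_T₂ : ∀ q, q ∈ T₂ ↔ q ∈ S ∧ ∀ t : k, elC t • q = q := by
    intro q
    rw [hT₂, hT₁, Finset.mem_filter, Finset.mem_filter]
    exact ⟨fun h => ⟨h.1.1, h.2⟩, fun h => ⟨⟨h.1, h.2 _, h.2 _⟩, h.2⟩⟩
  have sum_T₁_eq : ∑ q ∈ T₁, localTerm c u X Y a q = ∑ q ∈ T₂, localTerm c u X Y a q := by
    refine sum_eq_sum_fixed_of_affine hc0 hc1' (fun t q => elC t • q) (hone _ _ _) (hadd _ _ _)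
      T₁ ?_ _ (fun _ => 0) ?_
    · intro t q hq
      have h := Finset.mem_filter.1 hq
      refine Finset.mem_filter.2 ⟨hS _ _ h.1, ?_, ?_⟩
      · rw [← mul_smul, elC_mul_elC, mul_smul, h.2.1]
      · rw [← mul_smul, elC_mul_elC, mul_smul, h.2.2]
    · intro q hq t
      obtain ⟨h1, h2, h3⟩ := hsign q hq (elC t) (elC_mul_elC t)
      obtain ⟨r1, r2, r3, r4⟩ := hmat q hq
      simp only [localTerm, h1, h2, h3, ha, (elC_conj _ _).1, (elC_conj _ _).2.1, r1, r2]
      ring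
  have sum_T₂_eq : ∑ q ∈ T₂, localTerm c u X Y a q = ∑ q ∈ T₃, localTerm c u X Y a q := by
    refine sum_eq_sum_fixed_of_affine hc0 hc1' (fun t q => elA t • q) (hone _ _ _) (hadd _ _ _)
      T₂ ?_ _ (fun q => a q 1 2 * (signExp k (u (X * X) q) + signExp k (u (Y * Y) q) / c +
        signExp k (u ((X * Y) * (X * Y)) q) / (1 + c))) ?_
    · intro t q hq
      have h := (mem_T₂ q).1 hq
      refine (mem_T₂ _).2 ⟨hS _ _ h.1, fun s => ?_⟩
      rw [← mul_smul, ← elA_mul_elC, mul_smul, h.2]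
    · intro q hq t
      obtain ⟨h1, h2, h3⟩ := hsign q (Finset.mem_filter.1 hq).1 (elA t) (elA_mul_elC t)
      obtain ⟨r1, r2, r3, r4⟩ := hmat q (Finset.mem_filter.1 hq).1
      simp only [localTerm, h1, h2, h3, ha, (elA_conj _ _).1, (elA_conj _ _).2, r4]
      ring
  have sum_T₃_eq : ∑ q ∈ T₃, localTerm c u X Y a q = ∑ q ∈ T₄, localTerm c u X Y a q := by
    refine sum_eq_sum_fixed_of_affine hc0 hc1' (fun t q => elB t • q) (hone _ _ _) (hadd _ _ _)
      T₃ ?_ _ (fun q => a q 0 1 * (signExp k (u (X * X) q) + signExp k (u (Y * Y) q) / c +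
        signExp k (u ((X * Y) * (X * Y)) q) / (1 + c))) ?_
    · intro t q hq
      obtain ⟨hq2, hA⟩ := Finset.mem_filter.1 hq
      have h := (mem_T₂ q).1 hq2
      refine Finset.mem_filter.2 ⟨(mem_T₂ _).2 ⟨hS _ _ h.1, fun s => ?_⟩, fun s => ?_⟩
      · rw [← mul_smul, ← elB_mul_elC, mul_smul, h.2]
      · rw [← mul_smul, elA_mul_elB, mul_smul, hA, ← elB_mul_elC, mul_smul, h.2]
    · intro q hq t
      have hq1 := (Finset.mem_filter.1 (Finset.mem_filter.1 hq).1).1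
      obtain ⟨h1, h2, h3⟩ := hsign q hq1 (elB t) (elB_mul_elC t)
      simp only [localTerm, h1, h2, h3, ha, (elB_conj _ _).1, (elB_conj _ _).2]
      ring
  rw [sum_eq_sum_T₁, sum_T₁_eq, sum_T₂_eq, sum_T₃_eq]
  refine Finset.sum_eq_zero fun q hq => ?_
  obtain ⟨hq3, hB⟩ := Finset.mem_filter.1 hq
  obtain ⟨hq2, hA⟩ := Finset.mem_filter.1 hq3
  have hC := ((mem_T₂ q).1 hq2).2
  have htriv : ∀ (w : Γ) (t : k), ρ w = elC t → u (w * w) q = 1 := by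
    intro w t hw
    obtain ⟨α, hα⟩ := hρ (elA t)
    obtain ⟨β, hβ⟩ := hρ (elB 1)
    exact hu.sq_eq_one_of_commutator (α := α) (β := β) (by rw [hα, hβ, hw, elA_mul_elB, mul_one])
      (by rw [hα, hA]) (by rw [hβ, hB]) (by rw [hw, hC])
  simp only [localTerm, htriv X _ hX, htriv Y _ hY, htriv _ _ hZ, signExp_one]
  ring

end Vanishing

section PrimeRepresentatives

variable {R G : Type} [CommRing R] [IsDomain R] [Group G] [MulSemiringAction G R]

open scoped Pointwise in
theorem exists_irreducible_representatives :
    ∃ (P : Type) (_ : MulAction G P) (r : P → R), (∀ q, Irreducible (r q)) ∧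
      (∀ x, Irreducible x → ∃ q, Associated (r q) x) ∧
      (∀ q q', Associated (r q) (r q') → q = q') ∧
      ∀ (g : G) q, Associated (r (g • q)) (g • r q) := by
  have hirr (g : G) {x : R} (hx : Irreducible x) : Irreducible (g • x) :=
    (MulEquiv.irreducible_iff (MulSemiringAction.toRingEquiv G R g)).mpr hx
  have hspan (g : G) (x : R) : g • Ideal.span {x} = Ideal.span {g • x} := by
    rw [Ideal.smul_closure, Set.smul_set_singleton]
  let P := {I : Ideal R // ∃ x, Irreducible x ∧ Ideal.span {x} = I}
  let act : MulAction G P :=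
    { smul := fun g q => ⟨g • q.1, q.2.elim fun x hx => ⟨g • x, hirr g hx.1, by
        rw [← hspan, hx.2]⟩⟩
      one_smul := fun q => Subtype.ext (one_smul G q.1)
      mul_smul := fun g h q => Subtype.ext (mul_smul g h q.1) }
  choose r hr hspan_r using fun q : P => q.2
  refine ⟨P, act, r, hr, fun x hx => ⟨⟨_, x, hx, rfl⟩, ?_⟩, fun q q' h => ?_, fun g q => ?_⟩
  · exact Ideal.span_singleton_eq_span_singleton.mp (hspan_r _)
  · exact Subtype.ext ((hspan_r q).symm.trans
      ((Ideal.span_singleton_eq_span_singleton.mpr h).trans (hspan_r q')))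
  · rw [← Ideal.span_singleton_eq_span_singleton, hspan_r, ← hspan, hspan_r]
    rfl

end PrimeRepresentatives

section SquareRoots

variable {R Ω G Γ P : Type} [CommRing R] [Field Ω] [Group G] [Group Γ] [MulSemiringAction Γ Ω]

theorem smul_eq_of_mul_self_eq {x s : Ω} (h : x * x = s * s) {γ : Γ} (hs : γ • s = s) :
    γ • x = x := by
  rcases mul_self_eq_mul_self_iff.mp h with rfl | rfl
  · exact hs
  · rw [smul_neg, hs]

theorem signExp_eq_zero_iff {k K : Type} [Field k] [Field K] {s : K} :
    signExp k s = 0 ↔ s = 1 := by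
  unfold signExp
  split_ifs <;> simp_all

theorem isSignCocycle_sqrt [MulSemiringAction G R] [MulAction G P] (j : R →+* Ω) (ρ : Γ →* G)
    (hjρ : ∀ γ x, j (ρ γ • x) = γ • j x)
    (hunit : ∀ v : Rˣ, ∃ s : Ω, s * s = j v ∧ ∀ γ : Γ, γ • s = s)
    {r : P → R} (hr : ∀ (g : G) q, Associated (r (g • q)) (g • r q))
    {t : P → Ω} (ht0 : ∀ q, t q ≠ 0) (ht : ∀ q, t q * t q = j (r q)) :
    IsSignCocycle ρ fun γ q => (γ • t q) / t (ρ γ • q) := by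
  have hfixed (γ δ : Γ) (q : P) : δ • ((γ • t q) / t (ρ γ • q)) = (γ • t q) / t (ρ γ • q) := by
    obtain ⟨v, hv⟩ := hr (ρ γ) q
    obtain ⟨s, hs, hsfix⟩ := hunit v
    refine smul_eq_of_mul_self_eq (s := s) ?_ (hsfix δ)
    have h0 := ht0 (ρ γ • q)
    rw [div_mul_div_comm, ← smul_mul', ht, ← hjρ, ← hv, map_mul, ← ht, ← hs]
    field_simp
  refine ⟨fun γ δ q => ?_, fun n hn q => ?_⟩
  · have h := hfixed δ γ q
    rw [smul_div₀', div_eq_iff ((smul_ne_zero_iff_ne γ).mpr (ht0 _))] at h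
    simp only [map_mul, mul_smul] at h ⊢
    rw [h]
    have := ht0 (ρ γ • ρ δ • q)
    field_simp
  · rw [MonoidHom.mem_ker] at hn
    have h0 := ht0 q
    have h := hjρ n (r q)
    rw [hn, one_smul, ← ht, smul_mul'] at h
    simp only [hn, one_smul, div_mul_div_comm, ← h]
    field_simp

/-- Modulo squares, every nonzero element is a product of the chosen irreducible elements, so the
sign by which `ker ρ` acts on its square root is a product of the signs `u`. -/
theorem exists_sqrt_signExp [UniqueFactorizationMonoid R] (j : R →+* Ω) (ρ : Γ →* G)
    (hunit : ∀ v : Rˣ, ∃ s : Ω, s * s = j v ∧ ∀ γ : Γ, γ • s = s)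
    {r : P → R} (hr : ∀ x, Irreducible x → ∃ q, Associated (r q) x)
    {t : P → Ω} (ht : ∀ q, t q * t q = j (r q))
    {u : Γ → P → Ω} (hu : ∀ n ∈ ρ.ker, ∀ q, u n q * u n q = 1)
    (hut : ∀ n ∈ ρ.ker, ∀ q, n • t q = u n q * t q) (f : R) (hf : f ≠ 0) :
    ∃ (m : P →₀ ZMod 2) (y : Ω), y * y = j f ∧ ∀ n ∈ ρ.ker, ∃ σ : Ω, σ * σ = 1 ∧
      n • y = σ * y ∧ signExp (ZMod 2) σ = m.sum fun q e => e * signExp (ZMod 2) (u n q) := by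
  induction f using WfDvdMonoid.induction_on_irreducible with
  | zero => exact absurd rfl hf
  | unit v hv =>
    obtain ⟨v, rfl⟩ := hv
    obtain ⟨s, hs, hfix⟩ := hunit v
    exact ⟨0, s, hs, fun n _ => ⟨1, one_mul 1, by rw [hfix, one_mul], by
      simp [signExp_one]⟩⟩
  | mul a i ha0 hi ih =>
    obtain ⟨m, y, hy, hσ⟩ := ih ha0
    obtain ⟨q, v, hv⟩ := hr i hi
    obtain ⟨s, hs, hfix⟩ := hunit v
    refine ⟨Finsupp.single q 1 + m, t q * s * y, ?_, fun n hn => ?_⟩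
    · rw [← hv, map_mul, map_mul, ← hs, ← ht, ← hy]
      ring
    · obtain ⟨σ, h1, h2, h3⟩ := hσ n hn
      refine ⟨u n q * σ, ?_, ?_, ?_⟩
      · linear_combination σ * σ * hu n hn q + h1
      · rw [smul_mul', smul_mul', hut n hn, hfix, h2]
        ring
      · rw [signExp_mul (hu n hn q) h1, h3, Finsupp.sum_add_index' (by simp)
          (fun _ _ _ => add_mul _ _ _), Finsupp.sum_single_index (by simp), one_mul]

/-- Products of distinct irreducible elements are not squares in the fixed field of `ker ρ`. -/
theorem eq_empty_of_sum_signExp_eq_zero [IsDomain R] [UniqueFactorizationMonoid R]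
    (j : R →+* Ω) (hj : Function.Injective j) (ρ : Γ →* G)
    (hfix : ∀ x : Ω, (∀ n ∈ ρ.ker, n • x = x) → ∃ f g, g ≠ 0 ∧ x * j g = j f)
    {r : P → R} (hirr : ∀ q, Irreducible (r q))
    (hinj : ∀ q q', Associated (r q) (r q') → q = q')
    {t : P → Ω} (ht : ∀ q, t q * t q = j (r q))
    {u : Γ → P → Ω} (hu : ∀ n ∈ ρ.ker, ∀ q, u n q * u n q = 1)
    (hut : ∀ n ∈ ρ.ker, ∀ q, n • t q = u n q * t q) (T : Finset P)
    (hT : ∀ n ∈ ρ.ker, ∑ q ∈ T, signExp (ZMod 2) (u n q) = 0) : T = ∅ := by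
  classical
  have hexp (n : Γ) (hn : n ∈ ρ.ker) (S : Finset P) :
      (∏ q ∈ S, u n q) * (∏ q ∈ S, u n q) = 1 ∧
        ∑ q ∈ S, signExp (ZMod 2) (u n q) = signExp (ZMod 2) (∏ q ∈ S, u n q) := by
    induction S using Finset.induction_on with
    | empty => simp [signExp_one]
    | insert q S hq ih =>
      rw [Finset.prod_insert hq, Finset.sum_insert hq, signExp_mul (hu n hn q) ih.1, ih.2]
      exact ⟨by linear_combination (∏ q ∈ S, u n q) * (∏ q ∈ S, u n q) * hu n hn q + ih.1, rfl⟩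
  have hprod (n : Γ) (hn : n ∈ ρ.ker) : n • (∏ q ∈ T, t q) = ∏ q ∈ T, t q := by
    rw [Finset.smul_prod', Finset.prod_congr rfl fun q _ => hut n hn q, Finset.prod_mul_distrib,
      signExp_eq_zero_iff.mp ((hexp n hn T).2.symm.trans (hT n hn)), one_mul]
  obtain ⟨f, g, hg, hfg⟩ := hfix _ hprod
  have hsq : (∏ q ∈ T, r q) * g ^ 2 = f ^ 2 := hj <| by
    rw [map_mul, map_pow, map_pow, ← hfg, map_prod, ← Finset.prod_congr rfl fun q _ => ht q,
      Finset.prod_mul_distrib]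
    ring
  obtain ⟨h, rfl⟩ : g ∣ f :=
    (IsIntegrallyClosed.pow_dvd_pow_iff two_ne_zero).mp ⟨_, hsq.symm.trans (mul_comm _ _)⟩
  have hsq' : ∏ q ∈ T, r q = h ^ 2 :=
    mul_right_cancel₀ (pow_ne_zero 2 hg) (by rw [hsq]; ring)
  by_contra hne
  obtain ⟨q₀, hq₀⟩ := Finset.nonempty_iff_ne_empty.mpr hne
  have hp : Prime (r q₀) := (hirr q₀).prime
  obtain ⟨z, rfl⟩ : r q₀ ∣ h := hp.dvd_of_dvd_pow (hsq' ▸ Finset.dvd_prod_of_mem r hq₀)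
  rw [← Finset.mul_prod_erase T r hq₀] at hsq'
  have hdvd : r q₀ ∣ ∏ q ∈ T.erase q₀, r q :=
    ⟨z ^ 2, mul_left_cancel₀ hp.ne_zero (by rw [hsq']; ring)⟩
  obtain ⟨q, hq, hqdvd⟩ := hp.exists_mem_finset_dvd hdvd
  exact (Finset.mem_erase.mp hq).1
    (hinj _ _ (((hirr q₀).associated_of_dvd (hirr q) hqdvd).symm))

end SquareRoots

section KummerDecomposition

theorem eq_zero_of_finsum_signExp_smul_eq_zero {P Γ Ω M : Type} [Group Γ] [Field Ω]
    [AddCommGroup M] [Module (ZMod 2) M] {N : Subgroup Γ} {u : Γ → P → Ω}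
    (hind : ∀ T : Finset P, (∀ n ∈ N, ∑ q ∈ T, signExp (ZMod 2) (u n q) = 0) → T = ∅)
    {d : P → M} (hd : d.support.Finite)
    (h0 : ∀ n ∈ N, ∑ᶠ q, signExp (ZMod 2) (u n q) • d q = 0) : d = 0 := by
  classical
  funext q₀
  refine (Module.forall_dual_apply_eq_zero_iff (ZMod 2) (d q₀)).mp fun φ => ?_
  by_contra hφ
  have hT := hind (hd.toFinset.filter fun q => φ (d q) ≠ 0) fun n hn => by
    have h := congrArg φ (h0 n hn)
    rw [finsum_eq_sum_of_support_subset (s := hd.toFinset) _ (fun q hq => by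
      simp only [Set.Finite.coe_toFinset, Function.mem_support] at hq ⊢
      exact right_ne_zero_of_smul hq), map_sum, map_zero] at h
    rw [Finset.sum_filter]
    refine Eq.trans ?_ h
    refine Finset.sum_congr rfl fun q _ => ?_
    rw [map_smul, smul_eq_mul, ite_not]
    generalize φ (d q) = e
    obtain rfl | rfl : e = 0 ∨ e = 1 := by decide +revert
    · simp
    · simp
  have : q₀ ∈ (∅ : Finset P) := hT ▸ Finset.mem_filter.mpr
    ⟨hd.mem_toFinset.mpr fun h => hφ (by rw [h, map_zero]), hφ⟩
  exact Finset.notMem_empty _ this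

theorem exists_kummer_decomposition {R Ω G Γ M : Type} [CommRing R] [IsDomain R]
    [UniqueFactorizationMonoid R] [Field Ω] [Group G] [Group Γ] [MulSemiringAction G R]
    [MulSemiringAction Γ Ω] (j : R →+* Ω) (hj : Function.Injective j)
    (ρ : Γ →* G) (hρ : Function.Surjective ρ) (hjρ : ∀ γ x, j (ρ γ • x) = γ • j x)
    (hunit : ∀ v : Rˣ, ∃ s : Ω, s * s = j v ∧ ∀ γ : Γ, γ • s = s)
    (hsqrt : ∀ x : R, ∃ y : Ω, y * y = j x)
    (hfix : ∀ x : Ω, (∀ n ∈ ρ.ker, n • x = x) → ∃ f g, g ≠ 0 ∧ x * j g = j f)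
    [AddCommGroup M] [Module (ZMod 2) M] [Module.Finite (ZMod 2) M] (η : Γ → M)
    (hη : ∀ φ : M →ₗ[ZMod 2] ZMod 2, ∃ y : Ω, y ≠ 0 ∧ ∀ n ∈ ρ.ker, ∃ σ : Ω, σ * σ = 1 ∧
      n • y = σ * y ∧ φ (η n) = signExp (ZMod 2) σ)
    (τ : G → M →+ M) (hconj : ∀ γ, ∀ n ∈ ρ.ker, η (γ * n * γ⁻¹) = τ (ρ γ) (η n)) :
    ∃ (P : Type) (_ : MulAction G P) (u : Γ → P → Ω) (S : Finset P) (a : P → M),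
      IsSignCocycle ρ u ∧ (∀ g : G, ∀ q ∈ S, g • q ∈ S) ∧
      (∀ (g : G) q, a (g • q) = τ g (a q)) ∧
      ∀ n ∈ ρ.ker, η n = ∑ q ∈ S, signExp (ZMod 2) (u n q) • a q := by
  classical
  obtain ⟨P, _, r, hirr, hr, hinj, hGr⟩ := exists_irreducible_representatives (R := R) (G := G)
  choose t ht using fun q => hsqrt (r q)
  have ht0 (q : P) : t q ≠ 0 := fun h => (hirr q).ne_zero <| hj <| by
    rw [← ht, h, zero_mul, map_zero]
  set u : Γ → P → Ω := fun γ q => (γ • t q) / t (ρ γ • q) with hu_def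
  have hu : IsSignCocycle ρ u := isSignCocycle_sqrt j ρ hjρ hunit hGr ht0 ht
  have hut : ∀ n ∈ ρ.ker, ∀ q, n • t q = u n q * t q := fun n hn q => by
    simp only [hu_def, MonoidHom.mem_ker.mp hn, one_smul]
    exact (div_mul_cancel₀ _ (ht0 q)).symm
  have hind := eq_empty_of_sum_signExp_eq_zero j hj ρ hfix hirr hinj ht hu.sq_eq_one hut
  have hexp (φ : M →ₗ[ZMod 2] ZMod 2) : ∃ m : P →₀ ZMod 2, ∀ n ∈ ρ.ker,
      φ (η n) = m.sum fun q e => e * signExp (ZMod 2) (u n q) := by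
    obtain ⟨y, hy0, hy⟩ := hη φ
    have hyfix : ∀ n ∈ ρ.ker, n • (y * y) = y * y := fun n hn => by
      obtain ⟨σ, h1, h2, -⟩ := hy n hn
      rw [smul_mul', h2]
      linear_combination y * y * h1
    obtain ⟨f, g, hg, hfg⟩ := hfix _ hyfix
    have hjg : j g ≠ 0 := (map_ne_zero_iff j hj).mpr hg
    have hf : f ≠ 0 := by
      rintro rfl
      rw [map_zero] at hfg
      exact mul_ne_zero (mul_ne_zero hy0 hy0) hjg hfg
    obtain ⟨m, z, hz, hm⟩ := exists_sqrt_signExp j ρ hunit hr ht hu.sq_eq_one hut (f * g)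
      (mul_ne_zero hf hg)
    refine ⟨m, fun n hn => ?_⟩
    obtain ⟨σ, -, h2, h3⟩ := hy n hn
    obtain ⟨σ', -, h2', h3'⟩ := hm n hn
    have hng : n • j g = j g := by rw [← hjρ, MonoidHom.mem_ker.mp hn, one_smul]
    have hyz : y * j g = z ∨ y * j g = -z := mul_self_eq_mul_self_iff.mp <| by
      rw [hz, map_mul, ← hfg]
      ring
    have hz' : n • z = σ * z := by
      rcases hyz with h | h
      · rw [← h, smul_mul', hng, h2, mul_assoc]
      · rw [← neg_eq_iff_eq_neg.mpr h, smul_neg, smul_mul', hng, h2]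
        ring
    have hz0 : z ≠ 0 := by
      rintro rfl
      rw [mul_zero] at hz
      exact mul_ne_zero hf hg (hj (by rw [← hz, map_zero]))
    rw [h3, ← h3', mul_right_cancel₀ hz0 (hz'.symm.trans h2')]
  let b := Module.finBasis (ZMod 2) M
  choose m hm using fun i => hexp (b.coord i)
  let a : P → M := fun q => ∑ i, m i q • b i
  have ha : a.support.Finite := by
    refine (Finset.univ.biUnion fun i => (m i).support).finite_toSet.subset fun q hq => ?_
    obtain ⟨i, -, hi⟩ := Finset.exists_ne_zero_of_sum_ne_zero hq
    simp only [Finset.coe_biUnion, Set.mem_iUnion]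
    exact ⟨i, by simp, Finsupp.mem_support_iff.mpr (left_ne_zero_of_smul hi)⟩
  have hsupp (n : Γ) {d : P → M} (hd : d.support.Finite) :
      (Function.support fun q => signExp (ZMod 2) (u n q) • d q).Finite :=
    hd.subset fun q hq => right_ne_zero_of_smul hq
  have hηa : ∀ n ∈ ρ.ker, η n = ∑ᶠ q, signExp (ZMod 2) (u n q) • a q := fun n hn => by
    rw [finsum_eq_sum_of_support_subset (s := Finset.univ.biUnion fun i => (m i).support)]
    · rw [← b.sum_repr (η n)]
      simp only [a, Finset.smul_sum]
      rw [Finset.sum_comm]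
      refine Finset.sum_congr rfl fun i _ => ?_
      rw [← b.coord_apply, hm i n hn, Finsupp.sum, Finset.sum_smul]
      refine Finset.sum_subset_zero_on_sdiff (Finset.subset_biUnion_of_mem
        (fun i => (m i).support) (Finset.mem_univ i)) (fun q hq => ?_) fun q _ => ?_
      · rw [Finsupp.notMem_support_iff.mp (Finset.mem_sdiff.mp hq).2, zero_smul, smul_zero]
      · rw [smul_smul, mul_comm]
    · intro q hq
      obtain ⟨i, -, hi⟩ := Finset.exists_ne_zero_of_sum_ne_zero (right_ne_zero_of_smul hq)
      simp only [Finset.coe_biUnion, Set.mem_iUnion]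
      exact ⟨i, by simp, Finsupp.mem_support_iff.mpr (left_ne_zero_of_smul hi)⟩
  have hequiv (g : G) (q : P) : a (g • q) = τ g (a q) := by
    obtain ⟨γ, rfl⟩ := hρ g
    have hleft : (Function.support fun q => a (ρ γ • q)).Finite :=
      ha.preimage (MulAction.injective (ρ γ)).injOn
    have hright : (Function.support fun q => τ (ρ γ) (a q)).Finite :=
      ha.subset fun q hq h => hq (by simp only [h, map_zero])
    have hzero := eq_zero_of_finsum_signExp_smul_eq_zero (d := fun q => a (ρ γ • q) - τ (ρ γ) (a q))
      hind ((hleft.union hright).subset (Function.support_sub _ _)) fun n hn => by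
        simp only [smul_sub]
        rw [finsum_sub_distrib (hsupp n hleft) (hsupp n hright), sub_eq_zero]
        trans η (γ * n * γ⁻¹)
        · rw [hηa _ ((MonoidHom.normal_ker ρ).conj_mem n hn γ),
            ← finsum_comp_equiv (MulAction.toPerm (ρ γ))
              (f := fun q => signExp (ZMod 2) (u (γ * n * γ⁻¹) q) • a q)]
          simp only [MulAction.toPerm_apply, hu.conj γ hn]
        · rw [hconj γ n hn, hηa n hn, AddMonoidHom.map_finsum _ (hsupp n ha)]
          exact finsum_congr fun q => ZMod.map_smul _ _ _
    exact sub_eq_zero.mp (congrFun hzero q)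
  refine ⟨P, _, u, ha.toFinset, a, hu, fun g q hq => ?_, hequiv, fun n hn => ?_⟩
  · rw [Set.Finite.mem_toFinset, Function.mem_support] at hq ⊢
    intro h
    rw [← inv_smul_smul g q, hequiv, h, map_zero] at hq
    exact hq rfl
  · rw [hηa n hn]
    refine finsum_eq_sum_of_support_subset _ fun q hq => ?_
    rw [Set.Finite.coe_toFinset]
    exact right_ne_zero_of_smul hq

end KummerDecomposition

section GaloisRepresentation

/-- The Galois group of a finite Galois extension `L` of `F` is a quotient of the absolute Galois
group of `F`, with kernel cutting out a copy of `L`. -/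
theorem exists_absGal_surjection {F L : Type} [Field F] [Field L] [Algebra F L]
    [FiniteDimensional F L] [IsGalois F L] :
    ∃ (ρ : AbsGal F →* (L ≃ₐ[F] L)) (j : L →+* SeparableClosure F),
      Function.Surjective ρ ∧ IsOpen (ρ.ker : Set (AbsGal F)) ∧
      (∀ γ x, j (ρ γ x) = γ (j x)) ∧ ∀ y, (∀ n ∈ ρ.ker, n y = y) → ∃ x, j x = y := by
  let j : L →ₐ[F] SeparableClosure F := IsSepClosed.lift
  let : Algebra L (SeparableClosure F) := j.toRingHom.toAlgebra
  have : IsScalarTower F L (SeparableClosure F) := IsScalarTower.of_algHom j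
  let ρ : AbsGal F →* (L ≃ₐ[F] L) := AlgEquiv.restrictNormalHom L
  have hρj (γ : AbsGal F) (x : L) : j (ρ γ x) = γ (j x) := γ.restrictNormal_commutes L x
  have hker : ρ.ker = j.fieldRange.fixingSubgroup := by
    ext γ
    rw [IntermediateField.mem_fixingSubgroup_iff, MonoidHom.mem_ker]
    constructor
    · rintro h _ ⟨x, rfl⟩
      change γ (j x) = j x
      rw [← hρj, h, AlgEquiv.one_apply]
    · intro h
      ext x
      exact j.injective ((hρj γ x).trans (h (j x) ⟨x, rfl⟩))
  have : FiniteDimensional F j.fieldRange :=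
    (AlgEquiv.ofInjectiveField j).toLinearEquiv.finiteDimensional
  refine ⟨ρ, j, AlgEquiv.restrictNormalHom_surjective _, ?_, hρj, fun y hy => ?_⟩
  · rw [hker]
    exact j.fieldRange.fixingSubgroup_isOpen
  · have hy' : y ∈ IntermediateField.fixedField j.fieldRange.fixingSubgroup := by
      rw [IntermediateField.mem_fixedField_iff]
      exact fun n hn => hy n (hker ▸ hn)
    rwa [InfiniteGalois.fixedField_fixingSubgroup] at hy'

/-- A finite group acting faithfully on a domain `R` is a quotient of the absolute Galois group of
the fixed field of the fraction field of `R`. -/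
theorem exists_absGal_surjection_of_domain (G R : Type) [Group G] [Finite G] [CommRing R]
    [IsDomain R] [CharZero R] [MulSemiringAction G R] [FaithfulSMul G R] :
    ∃ (F : Type) (_ : Field F) (_ : CharZero F) (ρ : AbsGal F →* G) (j : R →+* SeparableClosure F),
      Function.Surjective ρ ∧ IsOpen (ρ.ker : Set (AbsGal F)) ∧ Function.Injective j ∧
      (∀ γ x, j (ρ γ • x) = γ (j x)) ∧
      ∀ y, (∀ n ∈ ρ.ker, n y = y) → ∃ f g, g ≠ 0 ∧ y * j g = j f := by
  let := IsFractionRing.mulSemiringAction G R (FractionRing R)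
  have := IsFractionRing.smulDistribClass G R (FractionRing R)
  have := IsFractionRing.faithfulSMul G R (FractionRing R)
  have : CharZero (FractionRing R) :=
    charZero_of_injective_algebraMap (IsFractionRing.injective R _)
  let F := FixedPoints.subfield G (FractionRing R)
  let e := FixedPoints.toAlgAutMulEquiv G (FractionRing R)
  have : IsGalois F (FractionRing R) := {}
  obtain ⟨ρ, j, hsurj, hopen, hρj, hfix⟩ := exists_absGal_surjection (F := F) (L := FractionRing R)
  have hker : (e.symm.toMonoidHom.comp ρ).ker = ρ.ker :=
    Subgroup.ext fun γ => e.symm.map_eq_one_iff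
  refine ⟨F, inferInstance, inferInstance, e.symm.toMonoidHom.comp ρ,
    j.comp (algebraMap R (FractionRing R)), e.symm.surjective.comp hsurj, by rwa [hker],
    j.injective.comp (IsFractionRing.injective R _), fun γ x => ?_, fun y hy => ?_⟩
  · rw [RingHom.comp_apply, RingHom.comp_apply, ← hρj]
    congr 1
    trans e (e.symm (ρ γ)) (algebraMap R _ x)
    · exact algebraMap.coe_smul' _ _ _
    · rw [MulEquiv.apply_symm_apply]
  · obtain ⟨x, rfl⟩ := hfix y (hker ▸ hy)
    obtain ⟨f, g, hg, rfl⟩ := IsFractionRing.div_surjective R x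
    refine ⟨f, g, nonZeroDivisors.ne_zero hg, ?_⟩
    rw [RingHom.comp_apply, RingHom.comp_apply, ← map_mul, div_mul_cancel₀]
    exact IsFractionRing.to_map_ne_zero_of_mem_nonZeroDivisors hg

/-- A continuous quadratic character of an open subgroup of an absolute Galois group in
characteristic zero is realised on an element of the separable closure. -/
theorem exists_ne_zero_smul_eq_sign {F : Type} [Field F] [CharZero F] (N H : Subgroup (AbsGal F))
    (hH : IsOpen (H : Set (AbsGal F))) (hHN : H ≤ N) (χ : AbsGal F → ZMod 2)
    (hχ : ∀ m ∈ N, ∀ n ∈ N, χ (m * n) = χ m + χ n) (hχH : ∀ n ∈ H, χ n = 0) :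
    ∃ y : SeparableClosure F, y ≠ 0 ∧ ∀ n ∈ N, ∃ σ : SeparableClosure F, σ * σ = 1 ∧
      n y = σ * y ∧ χ n = signExp (ZMod 2) σ := by
  by_cases htriv : ∀ n ∈ N, χ n = 0
  · exact ⟨1, one_ne_zero, fun n hn => ⟨1, one_mul 1, by simp, by rw [htriv n hn, signExp_one]⟩⟩
  push Not at htriv
  obtain ⟨n₀, hn₀, hχ₀⟩ := htriv
  have hone {z : ZMod 2} (hz : z ≠ 0) : z = 1 := by decide +revert
  let K : Subgroup (AbsGal F) :=
    { carrier := {n | n ∈ N ∧ χ n = 0}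
      one_mem' := ⟨one_mem N, hχH 1 (one_mem H)⟩
      mul_mem' := fun {a b} ha hb => ⟨mul_mem ha.1 hb.1, by
        rw [hχ a ha.1 b hb.1, ha.2, hb.2, add_zero]⟩
      inv_mem' := fun {a} ha => ⟨inv_mem ha.1, by
        have h := hχ a ha.1 a⁻¹ (inv_mem ha.1)
        rwa [mul_inv_cancel, hχH 1 (one_mem H), ha.2, zero_add, eq_comm] at h⟩ }
  have hKopen : IsOpen (K : Set (AbsGal F)) :=
    Subgroup.isOpen_mono (fun n hn => ⟨hHN hn, hχH n hn⟩ : H ≤ K) hH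
  have hK : (IntermediateField.fixedField K).fixingSubgroup = K :=
    InfiniteGalois.fixingSubgroup_fixedField ⟨K, K.isClosed_of_isOpen hKopen⟩
  have hn₀K : n₀ ∉ (IntermediateField.fixedField K).fixingSubgroup := by
    rw [hK]
    exact fun h => hχ₀ h.2
  rw [IntermediateField.mem_fixingSubgroup_iff] at hn₀K
  push Not at hn₀K
  obtain ⟨y, hyK, hy⟩ := hn₀K
  rw [IntermediateField.mem_fixedField_iff] at hyK
  have hinv : χ n₀⁻¹ = 1 := by
    have h := hχ n₀ hn₀ n₀⁻¹ (inv_mem hn₀)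
    rw [mul_inv_cancel, hχH 1 (one_mem H), hone hχ₀] at h
    generalize χ n₀⁻¹ = z at h
    decide +revert
  refine ⟨y - n₀ y, sub_ne_zero.mpr fun h => hy h.symm, fun n hn => ?_⟩
  have hnn₀ : χ (n₀⁻¹ * n) = 1 + χ n := by rw [hχ _ (inv_mem hn₀) n hn, hinv]
  by_cases hχn : χ n = 0
  · refine ⟨1, one_mul 1, ?_, by rw [hχn, signExp_one]⟩
    have h := hyK (n₀⁻¹ * n * n₀) ⟨mul_mem (mul_mem (inv_mem hn₀) hn) hn₀, by
      rw [hχ _ (mul_mem (inv_mem hn₀) hn) _ hn₀, hnn₀, hχn, hone hχ₀]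
      decide⟩
    rw [map_sub, hyK n ⟨hn, hχn⟩, one_mul]
    congr 1
    nth_rw 2 [← h]
    rw [← AlgEquiv.mul_apply, ← AlgEquiv.mul_apply]
    congr 1
    group
  · refine ⟨-1, by ring, ?_, ?_⟩
    · have h := hyK (n₀⁻¹ * n) ⟨mul_mem (inv_mem hn₀) hn, by
        rw [hnn₀, hone hχn]
        decide⟩
      have h' := hyK (n * n₀) ⟨mul_mem hn hn₀, by
        rw [hχ n hn n₀ hn₀, hone hχn, hone hχ₀]
        decide⟩
      have h1 : n y = n₀ y := by
        nth_rw 2 [← h]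
        rw [← AlgEquiv.mul_apply, mul_inv_cancel_left]
      rw [map_sub, h1, ← AlgEquiv.mul_apply, h']
      ring
    · rw [hone hχn, signExp, if_neg]
      have : CharZero (SeparableClosure F) :=
        charZero_of_injective_algebraMap (algebraMap F _).injective
      norm_num

end GaloisRepresentation

section RenamePolynomials

/-- The action of a group on the polynomials whose variables are its elements. -/
noncomputable abbrev renameAction (G K : Type) [Group G] [Field K] :
    MulSemiringAction G (MvPolynomial G K) :=
  MulSemiringAction.compHom _ (M := MvPolynomial G K ≃ₐ[K] MvPolynomial G K)
    { toFun := fun g => MvPolynomial.renameEquiv K (Equiv.mulLeft g)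
      map_one' := by
        ext1 p
        simp
      map_mul' := fun g h => by
        ext1 p
        simp only [AlgEquiv.mul_apply, MvPolynomial.renameEquiv_apply, MvPolynomial.rename_rename]
        congr 2
        ext x
        simp }

theorem renameAction_smul {G K : Type} [Group G] [Field K] (g : G) (p : MvPolynomial G K) :
    letI := renameAction G K
    g • p = MvPolynomial.rename (g * ·) p :=
  rfl

end RenamePolynomials

section NoLift

theorem elC_eq_one_add_corner {k : Type} [Field k] (t : k) : (elC t).1 = 1 + t • corner k := by
  ext i j
  fin_cases i <;> fin_cases j <;> simp [elementary, corner, Matrix.transvection]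

theorem signExp_smul {k K : Type} [Field k] [Algebra (ZMod 2) k] [Field K] (s : K) (x : k) :
    signExp (ZMod 2) s • x = signExp k s * x := by
  unfold signExp
  split_ifs <;> simp

theorem exists_absGal_not_liftable (k : Type) [Field k] [Finite k] [CharP k 2] {c : k} (hc0 : c ≠ 0)
    (hc1 : 1 + c ≠ 0) :
    ∃ (F : Type) (_ : Field F), ∃ ρ : AbsGal F →* GL (Fin 3) k, IsOpen (ρ.ker : Set (AbsGal F)) ∧
      ¬ ∃ ρ₂ : AbsGal F →* GL (Fin 3) (TruncatedWittVector 2 2 k),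
          IsOpen (ρ₂.ker : Set (AbsGal F)) ∧
          (Matrix.GeneralLinearGroup.map (wittRed 2 k)).comp ρ₂ = ρ := by
  have := Fintype.ofFinite k
  let := ZMod.algebra k 2
  let := renameAction (GL (Fin 3) k) ℂ
  have : FaithfulSMul (GL (Fin 3) k) (MvPolynomial (GL (Fin 3) k) ℂ) := ⟨fun {g h} H => by
    simpa [renameAction_smul] using H (MvPolynomial.X 1)⟩
  obtain ⟨F, _, _, ρ, j, hsurj, hopen, hj, hjρ, hfix⟩ :=
    exists_absGal_surjection_of_domain (GL (Fin 3) k) (MvPolynomial (GL (Fin 3) k) ℂ)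
  refine ⟨F, _, ρ, hopen, ?_⟩
  rintro ⟨ρ₂, hopen₂, hρ₂⟩
  have hker : ρ₂.ker ≤ ρ.ker := fun n hn => by
    rw [MonoidHom.mem_ker] at hn ⊢
    rw [← hρ₂, MonoidHom.comp_apply, hn, map_one]
  obtain ⟨η, hadd, hconj, hη₂, hone⟩ := exists_first_order_cocycle (wittRed 2 k) wittRed_surjective
    wittRed_eq_zero_iff_two_mul exists_two_mul_of_wittRed_eq_zero ρ ρ₂ hρ₂
  have : CharZero (SeparableClosure F) :=
    charZero_of_injective_algebraMap (algebraMap F _).injective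
  have : NeZero (2 : SeparableClosure F) := ⟨two_ne_zero⟩
  let τ (g : GL (Fin 3) k) : Matrix (Fin 3) (Fin 3) k →+ Matrix (Fin 3) (Fin 3) k :=
    (AddMonoidHom.mulRight g⁻¹.1).comp (AddMonoidHom.mulLeft g.1)
  obtain ⟨P, _, u, S, a, hu, hS, ha, hηa⟩ := exists_kummer_decomposition j hj ρ hsurj hjρ
    (fun v => by
      obtain ⟨z, -, hz⟩ := MvPolynomial.isUnit_iff_eq_C_of_isReduced.mp v.isUnit
      obtain ⟨s, hs⟩ := IsAlgClosed.exists_eq_mul_self z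
      refine ⟨j (MvPolynomial.C s), by rw [← map_mul, ← map_mul, ← hs, hz], fun γ => ?_⟩
      rw [AlgEquiv.smul_def, ← hjρ, renameAction_smul, MvPolynomial.rename_C])
    (fun x => (IsSepClosed.exists_eq_mul_self (j x)).imp fun _ h => h.symm)
    hfix η
    (fun φ => exists_ne_zero_smul_eq_sign ρ.ker ρ₂.ker hopen₂ hker (fun n => φ (η n))
      (fun m hm n hn => by rw [hadd m hm n hn, map_add]) fun n hn => by rw [hη₂ n hn, map_zero])
    τ hconj
  obtain ⟨X, hX⟩ := hsurj (elC 1)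
  obtain ⟨Y, hY⟩ := hsurj (elC c)
  have hone := hone c X Y hc0 hc1 (by rw [hX, elC_eq_one_add_corner, one_smul])
    (by rw [hY, elC_eq_one_add_corner])
  have hzero := sum_localTerm_eq_zero hc0 hc1 hsurj hu S hS a ha hX hY
  have hsq (t : k) : elC t * elC t = 1 := by
    rw [← elementary_add, CharTwo.add_self_eq_zero, elementary_zero]
  have hXX : X * X ∈ ρ.ker := by rw [MonoidHom.mem_ker, map_mul, hX, hsq]
  have hYY : Y * Y ∈ ρ.ker := by rw [MonoidHom.mem_ker, map_mul, hY, hsq]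
  have hXY : (X * Y) * (X * Y) ∈ ρ.ker := by
    rw [MonoidHom.mem_ker, map_mul, map_mul, hX, hY, ← elementary_add, hsq]
  have hentry (n : AbsGal F) (hn : n ∈ ρ.ker) (i l : Fin 3) :
      η n i l = ∑ q ∈ S, signExp k (u n q) * a q i l := by
    rw [hηa n hn, Matrix.sum_apply]
    exact Finset.sum_congr rfl fun q _ => signExp_smul _ _
  rw [hentry _ hXX, hentry _ hYY, hentry _ hXY, hentry _ hXX, hentry _ hYY, Finset.sum_div,
    Finset.sum_div, Finset.sum_div, Finset.mul_sum, ← Finset.sum_add_distrib,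
    ← Finset.sum_add_distrib, ← Finset.sum_add_distrib, ← Finset.sum_add_distrib] at hone
  refine zero_ne_one (α := k)
    (hzero.symm.trans (Eq.trans (Finset.sum_congr rfl fun q _ => ?_) hone))
  unfold localTerm
  ring

end NoLift

theorem stmt_6 (r : ℕ) (hr : 2 ≤ r) :
    ∃ (F : Type) (_ : Field F),
      ∃ ρ : AbsGal F →* GL (Fin 3) (GaloisField 2 r),
        IsOpen (ρ.ker : Set (AbsGal F)) ∧
        ¬ ∃ ρ₂ : AbsGal F →* GL (Fin 3) (TruncatedWittVector 2 2 (GaloisField 2 r)),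
            IsOpen (ρ₂.ker : Set (AbsGal F)) ∧
            (Matrix.GeneralLinearGroup.map (wittRed 2 (GaloisField 2 r))).comp ρ₂ = ρ := by
  classical
  have := Fintype.ofFinite (GaloisField 2 r)
  have hcard : 2 < Fintype.card (GaloisField 2 r) := by
    rw [← Nat.card_eq_fintype_card, GaloisField.card 2 r (by omega)]
    exact lt_of_lt_of_le (by norm_num) (Nat.pow_le_pow_right two_pos hr)
  obtain ⟨c, hc⟩ := Finset.exists_mem_notMem_of_card_lt_card
    (s := ({0, 1} : Finset (GaloisField 2 r))) (t := Finset.univ)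
    (lt_of_le_of_lt Finset.card_le_two hcard)
  simp only [Finset.mem_insert, Finset.mem_singleton, not_or] at hc
  refine exists_absGal_not_liftable (GaloisField 2 r) hc.2.1 fun h => hc.2.2 ?_
  rw [← CharTwo.neg_eq (1 : GaloisField 2 r)]
  exact eq_neg_of_add_eq_zero_right h
end
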